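/- arXiv:0904.1176 — 4 statements merged into one kernel-verified Lean document; each statement's English description precedes it below -/
import Mathlib

section
/- Zolotarev duality: Let 1 < α ≤ 2 and let η be a real number with |η| ≤ 2 − α. Then for all u > 0, p_α(u; η, 1) = u^{−(1+α)} · p_{α*}(u^{−α}; η*, 1), where α* = 1/α and η* = (η − 1)/α + 1. -/
open MeasureTheory Real Set

/-- Zolotarev's parametrization of the stable density: the real-valued inverse Fourier
integral `p_α(x; η, b) = (1/(2π)) ∫ e^{-iλx} exp(-b|λ|^α e^{-iπη·sgn(λ)/2}) dλ`. -/
noncomputable def zolDensity (α η b x : ℝ) : ℝ :=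
  (1 / (2 * Real.pi)) *
    (∫ l : ℝ, Complex.exp (-Complex.I * (l : ℂ) * (x : ℂ)) *
        Complex.exp (-(b : ℂ) * ((|l| ^ α : ℝ) : ℂ) *
          Complex.exp (-Complex.I * (Real.pi : ℂ) * (η : ℂ) * ((Real.sign l : ℝ) : ℂ) / 2))).re


/-- Integrand on the ray of argument `φ`. -/
noncomputable def rayK (β δ x r φ : ℝ) : ℂ :=
  Complex.exp (φ * Complex.I + Complex.I * x * r * Complex.exp (φ * Complex.I)
    - ((r ^ β : ℝ) : ℂ) * Complex.exp (((β * φ + δ : ℝ) : ℂ) * Complex.I))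

/-- Logarithmic factor. -/
noncomputable def rayA (β δ x r φ : ℝ) : ℂ :=
  1 + Complex.I * x * r * Complex.exp (φ * Complex.I)
    - β * ((r ^ β : ℝ) : ℂ) * Complex.exp (((β * φ + δ : ℝ) : ℂ) * Complex.I)

lemma rayK_norm (β δ x r φ : ℝ) :
    ‖rayK β δ x r φ‖ = Real.exp (-(x * r * Real.sin φ + r ^ β * Real.cos (β * φ + δ))) := by
  rw [rayK, Complex.norm_exp]
  congr 1
  simp only [Complex.sub_re, Complex.add_re, Complex.mul_re, Complex.mul_im, Complex.ofReal_re, Complex.ofReal_im,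
    Complex.I_re, Complex.I_im, Complex.exp_ofReal_mul_I_re, Complex.exp_ofReal_mul_I_im]
  ring

lemma rayA_norm {β x r : ℝ} (δ φ : ℝ) (hβ : 0 < β) (hx : 0 < x) (hr : 0 < r) :
    ‖rayA β δ x r φ‖ ≤ 1 + x * r + β * r ^ β := by
  have hrb : 0 < r ^ β := Real.rpow_pos_of_pos hr _
  rw [rayA]
  refine (norm_sub_le _ _).trans ?_
  refine add_le_add ((norm_add_le _ _).trans ?_) ?_
  · simp [Complex.norm_exp_ofReal_mul_I, abs_of_pos hx, abs_of_pos hr]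
  · simp only [norm_mul, Complex.norm_exp_ofReal_mul_I, Complex.norm_real, Real.norm_eq_abs,
      abs_of_pos hβ, abs_of_pos hrb]
    simp

lemma ray_min {β δ x θ : ℝ} (hβ : 0 < β) (hx : 0 < x) (hθ0 : 0 < θ) (hθ : θ < π)
    (hδ : -(π/2) < δ) (h : β * θ + δ = π / 2) :
    ∃ m : ℝ, 0 < m ∧ ∀ φ ∈ Icc 0 θ, m ≤ x * Real.sin φ + Real.cos (β * φ + δ) := by
  obtain ⟨φ₀, h0, hmin⟩ := (isCompact_Icc (a := (0:ℝ)) (b := θ)).exists_isMinOn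
    (nonempty_Icc.2 hθ0.le)
    (f := fun φ => x * Real.sin φ + Real.cos (β * φ + δ)) (by fun_prop)
  refine ⟨_, ?_, fun φ hφ => hmin hφ⟩
  have h1 : β * φ₀ ≤ β * θ := by gcongr; exact h0.2
  have h2 : 0 ≤ β * φ₀ := mul_nonneg hβ.le h0.1
  rcases h0.1.eq_or_lt with h3 | h3
  · rw [← h3]
    have : 0 < β * θ := by positivity
    have : 0 < Real.cos δ := Real.cos_pos_of_mem_Ioo ⟨by linarith, by linarith⟩
    simpa using this
  · have : 0 < Real.sin φ₀ := Real.sin_pos_of_pos_of_lt_pi h3 (by linarith [h0.2])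
    have : 0 ≤ Real.cos (β * φ₀ + δ) :=
      Real.cos_nonneg_of_mem_Icc ⟨by linarith, by linarith⟩
    positivity

lemma ray_bound {β δ x θ : ℝ} (hβ : 0 < β) (hβ1 : β ≤ 1) (hx : 0 < x) (hθ0 : 0 < θ) (hθ : θ < π)
    (hδ : -(π/2) < δ) (h : β * θ + δ = π / 2) :
    ∃ m : ℝ, 0 < m ∧ ∀ φ ∈ Icc 0 θ, ∀ r : ℝ, 0 < r →
      ‖rayK β δ x r φ‖ ≤ Real.exp m * Real.exp (-m * r ^ β) := by
  obtain ⟨m, hm, H⟩ := ray_min hβ hx hθ0 hθ hδ h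
  refine ⟨m, hm, fun φ hφ r hr => ?_⟩
  rw [rayK_norm, ← Real.exp_add, Real.exp_le_exp]
  have hs : 0 ≤ Real.sin φ := Real.sin_nonneg_of_nonneg_of_le_pi hφ.1 (by linarith [hφ.2])
  have hb1 : β * φ ≤ β * θ := by gcongr; exact hφ.2
  have hb2 : 0 ≤ β * φ := mul_nonneg hβ.le hφ.1
  have hc : 0 ≤ Real.cos (β * φ + δ) :=
    Real.cos_nonneg_of_mem_Icc ⟨by linarith, by linarith⟩
  have hrb : 0 < r ^ β := Real.rpow_pos_of_pos hr _
  rcases le_total 1 r with h1 | h1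
  · have h2 : r ^ β ≤ r := by simpa using Real.rpow_le_rpow_of_exponent_le h1 hβ1
    have h3 : m * r ^ β ≤ (x * Real.sin φ + Real.cos (β * φ + δ)) * r ^ β := by
      gcongr; exact H φ hφ
    have h4 : x * Real.sin φ * r ^ β ≤ x * Real.sin φ * r := by gcongr
    nlinarith
  · have h2 : r ^ β ≤ 1 := Real.rpow_le_one hr.le h1 hβ.le
    have h3 : m * r ^ β ≤ m * 1 := by gcongr
    have : 0 ≤ x * r * Real.sin φ := by positivity
    have : 0 ≤ r ^ β * Real.cos (β * φ + δ) := by positivity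
    linarith

lemma rayK_deriv_phi (β δ x r φ : ℝ) :
    HasDerivAt (fun φ => rayK β δ x r φ) (Complex.I * (rayA β δ x r φ * rayK β δ x r φ)) φ := by
  have h0 : HasDerivAt (fun φ : ℝ => (φ : ℂ)) 1 φ := Complex.ofRealCLM.hasDerivAt
  have h1 : HasDerivAt (fun φ : ℝ => (((β * φ + δ : ℝ) : ℂ))) β φ := by
    have := ((h0.const_mul (β : ℂ)).add_const (δ : ℂ))
    simpa using this
  have h2 := (h0.mul_const Complex.I).cexp
  have h3 := (h1.mul_const Complex.I).cexp
  have h4 := (((h0.mul_const Complex.I).add (h2.const_mul (Complex.I * x * r))).sub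
    (h3.const_mul ((r ^ β : ℝ) : ℂ))).cexp
  refine HasDerivAt.congr_deriv (f := fun φ => rayK β δ x r φ) h4 ?_
  simp only [rayA, rayK, Pi.sub_apply, Pi.add_apply]
  ring

lemma rayK_deriv_r (β δ x φ : ℝ) {r : ℝ} (hr : 0 < r) :
    HasDerivAt (fun r : ℝ => (r : ℂ) * rayK β δ x r φ) (rayA β δ x r φ * rayK β δ x r φ) r := by
  have h0 : HasDerivAt (fun r : ℝ => (r : ℂ)) 1 r := Complex.ofRealCLM.hasDerivAt
  have h1 : HasDerivAt (fun r : ℝ => ((r ^ β : ℝ) : ℂ)) ((β * r ^ (β - 1) : ℝ) : ℂ) r :=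
    (Real.hasDerivAt_rpow_const (Or.inl hr.ne')).ofReal_comp
  have h4 := (((h0.const_mul (Complex.I * x)).mul_const (Complex.exp (φ * Complex.I))).const_add
    (φ * Complex.I)).sub (h1.mul_const (Complex.exp (((β * φ + δ : ℝ) : ℂ) * Complex.I)))
  have h5 := h0.mul h4.cexp
  refine HasDerivAt.congr_deriv (f := fun r : ℝ => (r : ℂ) * rayK β δ x r φ) h5 ?_
  have h6 : ((r ^ β : ℝ) : ℂ) = r * ((r ^ (β - 1) : ℝ) : ℂ) := by
    rw [← Complex.ofReal_mul, mul_comm r, Real.rpow_sub_one hr.ne', div_mul_cancel₀ _ hr.ne']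
  simp only [rayA, rayK, Pi.sub_apply, Pi.add_apply]
  rw [h6]
  push_cast
  ring

lemma rayK_cont_r {β : ℝ} (hβ : 0 < β) (δ x φ : ℝ) : Continuous (fun r => rayK β δ x r φ) := by
  have : Continuous (fun r : ℝ => r ^ β) := Real.continuous_rpow_const hβ.le
  unfold rayK
  fun_prop

lemma rayA_cont_r {β : ℝ} (hβ : 0 < β) (δ x φ : ℝ) : Continuous (fun r => rayA β δ x r φ) := by
  have : Continuous (fun r : ℝ => r ^ β) := Real.continuous_rpow_const hβ.le
  unfold rayA
  fun_prop

lemma ray_int0 {β m : ℝ} (hβ : 0 < β) (hm : 0 < m) :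
    IntegrableOn (fun r : ℝ => Real.exp m * Real.exp (-m * r ^ β)) (Ioi 0) := by
  have h0 := integrableOn_rpow_mul_exp_neg_mul_rpow (s := 0) (by norm_num) hβ hm
  simp only [Real.rpow_zero, one_mul] at h0
  exact h0.const_mul _

lemma ray_int1 {β m : ℝ} (x : ℝ) (hβ : 0 < β) (hm : 0 < m) :
    IntegrableOn (fun r : ℝ => (1 + x * r + β * r ^ β) * (Real.exp m * Real.exp (-m * r ^ β)))
      (Ioi 0) := by
  have h0 := integrableOn_rpow_mul_exp_neg_mul_rpow (s := 0) (by norm_num) hβ hm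
  have h1 := integrableOn_rpow_mul_exp_neg_mul_rpow (s := 1) (by norm_num) hβ hm
  have h2 := integrableOn_rpow_mul_exp_neg_mul_rpow (s := β) (by linarith) hβ hm
  have := ((h0.const_mul (Real.exp m)).add (h1.const_mul (x * Real.exp m))).add
    (h2.const_mul (β * Real.exp m))
  refine this.congr (ae_of_all _ fun r => ?_)
  simp only [Pi.add_apply, Real.rpow_zero, Real.rpow_one]
  ring

lemma ray_tendsto {β m : ℝ} (hβ : 0 < β) (hm : 0 < m) :
    Filter.Tendsto (fun r : ℝ => r * (Real.exp m * Real.exp (-m * r ^ β))) Filter.atTop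
      (nhds 0) := by
  have h := ((tendsto_rpow_mul_exp_neg_mul_atTop_nhds_zero β⁻¹ m hm).comp
    (tendsto_rpow_atTop hβ)).const_mul (Real.exp m)
  rw [mul_zero] at h
  refine h.congr' ?_
  filter_upwards [Filter.eventually_gt_atTop 0] with r hr
  simp only [Function.comp]
  rw [Real.rpow_rpow_inv hr.le hβ.ne']
  ring

lemma ray_rotation {β δ x θ : ℝ} (hβ : 0 < β) (hβ1 : β ≤ 1) (hx : 0 < x) (hθ0 : 0 < θ) (hθ : θ < π)
    (hδ : -(π/2) < δ) (h : β * θ + δ = π / 2) :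
    ∫ r in Ioi (0:ℝ), rayK β δ x r θ = ∫ r in Ioi (0:ℝ), rayK β δ x r 0 := by
  obtain ⟨m, hm, H⟩ := ray_bound hβ hβ1 hx hθ0 hθ hδ h
  have hI0 := ray_int0 hβ hm
  have hI1 := ray_int1 x hβ hm
  have hAK : ∀ φ ∈ Icc 0 θ, ∀ r : ℝ, 0 < r → ‖rayA β δ x r φ * rayK β δ x r φ‖ ≤
      (1 + x * r + β * r ^ β) * (Real.exp m * Real.exp (-m * r ^ β)) := by
    intro φ hφ r hr
    rw [norm_mul]
    have := Real.rpow_pos_of_pos hr β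
    gcongr
    · exact rayA_norm δ φ hβ hx hr
    · exact H φ hφ r hr
  have hAKint : ∀ φ ∈ Icc 0 θ, IntegrableOn (fun r => rayA β δ x r φ * rayK β δ x r φ) (Ioi 0) := by
    intro φ hφ
    refine Integrable.mono' hI1
      ((rayA_cont_r hβ δ x φ).mul (rayK_cont_r hβ δ x φ)).aestronglyMeasurable ?_
    filter_upwards [ae_restrict_mem measurableSet_Ioi] with r hr
    exact hAK φ hφ r hr
  have hzero : ∀ φ ∈ Icc 0 θ, ∫ r in Ioi (0:ℝ), rayA β δ x r φ * rayK β δ x r φ = 0 := by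
    intro φ hφ
    have := integral_Ioi_of_hasDerivAt_of_tendsto (a := 0) (m := (0:ℂ))
      (f := fun r : ℝ => (r : ℂ) * rayK β δ x r φ)
      (f' := fun r => rayA β δ x r φ * rayK β δ x r φ)
      ((Complex.continuous_ofReal.mul (rayK_cont_r hβ δ x φ)).continuousWithinAt)
      (fun r hr => rayK_deriv_r β δ x φ hr) (hAKint φ hφ) ?_
    · simpa using this
    · refine squeeze_zero_norm' ?_ (ray_tendsto hβ hm)
      filter_upwards [Filter.eventually_gt_atTop 0] with r hr
      rw [norm_mul, Complex.norm_real, Real.norm_eq_abs, abs_of_pos hr]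
      gcongr
      exact H φ hφ r hr
  have hcont : ContinuousOn (fun φ => ∫ r in Ioi (0:ℝ), rayK β δ x r φ) (Icc 0 θ) := by
    refine continuousOn_of_dominated
      (bound := fun r => Real.exp m * Real.exp (-m * r ^ β)) ?_ ?_ hI0 ?_
    · intro φ _
      exact (rayK_cont_r hβ δ x φ).aestronglyMeasurable
    · intro φ hφ
      filter_upwards [ae_restrict_mem measurableSet_Ioi] with r hr
      exact H φ hφ r hr
    · refine ae_of_all _ fun r φ _ => (rayK_deriv_phi β δ x r φ).continuousAt.continuousWithinAt
  have hder : ∀ φ ∈ Ioo 0 θ, HasDerivAt (fun φ => ∫ r in Ioi (0:ℝ), rayK β δ x r φ) 0 φ := by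
    intro φ hφ
    have := (hasDerivAt_integral_of_dominated_loc_of_deriv_le (𝕜 := ℝ)
      (μ := volume.restrict (Ioi (0:ℝ)))
      (F := fun φ r => rayK β δ x r φ)
      (F' := fun φ r => Complex.I * (rayA β δ x r φ * rayK β δ x r φ))
      (bound := fun r => (1 + x * r + β * r ^ β) * (Real.exp m * Real.exp (-m * r ^ β)))
      (x₀ := φ) (s := Ioo 0 θ) (Ioo_mem_nhds hφ.1 hφ.2) ?_ ?_ ?_ ?_ hI1 ?_).2
    · rw [integral_const_mul, hzero φ (Ioo_subset_Icc_self hφ), mul_zero] at this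
      exact this
    · exact Filter.Eventually.of_forall fun φ => (rayK_cont_r hβ δ x φ).aestronglyMeasurable
    · refine Integrable.mono' hI0 (rayK_cont_r hβ δ x φ).aestronglyMeasurable ?_
      filter_upwards [ae_restrict_mem measurableSet_Ioi] with r hr
      exact H φ (Ioo_subset_Icc_self hφ) r hr
    · exact (continuous_const.mul ((rayA_cont_r hβ δ x φ).mul
        (rayK_cont_r hβ δ x φ))).aestronglyMeasurable
    · filter_upwards [ae_restrict_mem measurableSet_Ioi] with r hr φ hφ
      rw [norm_mul, Complex.norm_I, one_mul]
      exact hAK φ (Ioo_subset_Icc_self hφ) r hr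
    · exact ae_of_all _ fun r φ _ => rayK_deriv_phi β δ x r φ
  have := intervalIntegral.integral_eq_sub_of_hasDerivAt_of_le hθ0.le hcont hder (by simp)
  simp only [intervalIntegral.integral_zero] at this
  exact (sub_eq_zero.1 this.symm)

/-- Half-line integrand. -/
noncomputable def halfK (α η x l : ℝ) : ℂ :=
  Complex.exp (-(Complex.I * x * l) - ((l ^ α : ℝ) : ℂ) *
    Complex.exp (((-(π * η / 2) : ℝ) : ℂ) * Complex.I))

lemma halfK_norm (α η x l : ℝ) :
    ‖halfK α η x l‖ = Real.exp (-Real.cos (π * η / 2) * l ^ α) := by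
  rw [halfK, Complex.norm_exp]
  congr 1
  simp only [Complex.sub_re, Complex.neg_re, Complex.mul_re, Complex.mul_im, Complex.ofReal_re,
    Complex.ofReal_im, Complex.I_re, Complex.I_im, Complex.exp_ofReal_mul_I_re,
    Complex.exp_ofReal_mul_I_im, Real.cos_neg]
  ring

lemma cos_eta_pos {η : ℝ} (hη : |η| < 1) : 0 < Real.cos (π * η / 2) := by
  have := abs_lt.1 hη
  have := Real.pi_pos
  apply Real.cos_pos_of_mem_Ioo
  constructor <;> nlinarith

lemma halfK_cont {α : ℝ} (hα : 0 < α) (η x : ℝ) : Continuous (halfK α η x) := by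
  have : Continuous (fun r : ℝ => r ^ α) := Real.continuous_rpow_const hα.le
  unfold halfK
  fun_prop

lemma halfK_int {α η : ℝ} (hα : 0 < α) (hη : |η| < 1) (x : ℝ) :
    IntegrableOn (halfK α η x) (Ioi 0) := by
  have h0 := integrableOn_rpow_mul_exp_neg_mul_rpow (s := 0) (by norm_num) hα (cos_eta_pos hη)
  simp only [Real.rpow_zero, one_mul] at h0
  refine Integrable.mono' h0 (halfK_cont hα η x).aestronglyMeasurable ?_
  exact ae_of_all _ fun r => (halfK_norm α η x r).le

lemma zol_half {α η : ℝ} (hα : 0 < α) (hη : |η| < 1) (x : ℝ) :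
    zolDensity α η 1 x = (1 / π) * (∫ l in Ioi (0:ℝ), halfK α η x l).re := by
  unfold zolDensity
  set f : ℝ → ℂ := fun l => Complex.exp (-Complex.I * (l : ℂ) * (x : ℂ)) *
        Complex.exp (-((1:ℝ) : ℂ) * ((|l| ^ α : ℝ) : ℂ) *
          Complex.exp (-Complex.I * (Real.pi : ℂ) * (η : ℂ) * ((Real.sign l : ℝ) : ℂ) / 2)) with hf
  have hpos : ∀ l ∈ Ioi (0:ℝ), f l = halfK α η x l := by
    intro l hl
    have hl' : (0:ℝ) < l := hl
    simp only [hf, halfK, Real.sign_of_pos hl', abs_of_pos hl', ← Complex.exp_add]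
    have : -Complex.I * (π : ℂ) * η * ((1:ℝ):ℂ) / 2 = ((-(π * η / 2) : ℝ) : ℂ) * Complex.I := by
      push_cast; ring
    rw [this]
    congr 1
    push_cast; ring
  have hneg : ∀ l ∈ Ioi (0:ℝ), f (-l) = (starRingEnd ℂ) (halfK α η x l) := by
    intro l hl
    have hl' : (0:ℝ) < l := hl
    simp only [hf, halfK, Real.sign_neg, Real.sign_of_pos hl', abs_neg, abs_of_pos hl',
      ← Complex.exp_add, ← Complex.exp_conj, map_sub, map_neg, map_mul, Complex.conj_ofReal,
      Complex.conj_I]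
    have : -Complex.I * (π : ℂ) * η * ((-1:ℝ):ℂ) / 2 = ((-(π * η / 2) : ℝ) : ℂ) * -Complex.I := by
      push_cast; ring
    rw [this]
    congr 1
    push_cast; ring
  have hK := halfK_int hα hη x
  have hR : IntegrableOn f (Ioi 0) := hK.congr_fun (fun l hl => (hpos l hl).symm) measurableSet_Ioi
  have hK' : IntegrableOn (fun l => (starRingEnd ℂ) (halfK α η x l)) (Ioi 0) :=
    Complex.conjCLE.toContinuousLinearMap.integrable_comp hK
  have hL' : IntegrableOn (fun l => f (-l)) (Ioi 0) :=
    hK'.congr_fun (fun l hl => (hneg l hl).symm) measurableSet_Ioi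
  have hL : IntegrableOn f (Iic 0) := by
    rw [integrableOn_Iic_iff_integrableOn_Iio]
    have := (Measure.measurePreserving_neg (volume : Measure ℝ)).integrableOn_comp_preimage
      (Homeomorph.neg ℝ).measurableEmbedding (f := f) (s := Iio 0)
    refine this.1 ?_
    simpa using! hL'
  have e1 : ∫ l in Iic (0:ℝ), f l = (starRingEnd ℂ) (∫ l in Ioi (0:ℝ), halfK α η x l) := by
    have := integral_comp_neg_Ioi (0:ℝ) f
    rw [neg_zero] at this
    rw [← this, ← integral_conj]
    exact setIntegral_congr_fun measurableSet_Ioi hneg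
  have e2 : ∫ l in Ioi (0:ℝ), f l = ∫ l in Ioi (0:ℝ), halfK α η x l :=
    setIntegral_congr_fun measurableSet_Ioi hpos
  rw [← intervalIntegral.integral_Iic_add_Ioi hL hR, e1, e2, Complex.add_re, Complex.conj_re]
  field_simp
  ring

lemma conj_halfK (β η x : ℝ) :
    (∫ l in Ioi (0:ℝ), halfK β η x l).re = (∫ l in Ioi (0:ℝ), rayK β (π * η / 2) x l 0).re := by
  have : ∀ l, rayK β (π * η / 2) x l 0 = (starRingEnd ℂ) (halfK β η x l) := by
    intro l
    simp only [rayK, halfK, ← Complex.exp_conj, map_sub, map_neg, map_mul, Complex.conj_ofReal,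
      Complex.conj_I]
    simp
  simp_rw [this]
  rw [integral_conj, Complex.conj_re]

/-- Integrand after the substitution. -/
noncomputable def parK (α η x v : ℝ) : ℂ :=
  Complex.exp (-((x : ℂ) * ((v ^ α : ℝ) : ℂ) *
    Complex.exp (((-(π * η / 2) : ℝ) : ℂ) * Complex.I)) - Complex.I * v)

lemma parK_norm (α η x l : ℝ) :
    ‖parK α η x l‖ = Real.exp (-(x * Real.cos (π * η / 2)) * l ^ α) := by
  rw [parK, Complex.norm_exp]
  congr 1
  simp only [Complex.sub_re, Complex.neg_re, Complex.mul_re, Complex.mul_im, Complex.ofReal_re,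
    Complex.ofReal_im, Complex.I_re, Complex.I_im, Complex.exp_ofReal_mul_I_re,
    Complex.exp_ofReal_mul_I_im, Real.cos_neg]
  ring

lemma parK_cont {α : ℝ} (hα : 0 < α) (η x : ℝ) : Continuous (parK α η x) := by
  have : Continuous (fun r : ℝ => r ^ α) := Real.continuous_rpow_const hα.le
  unfold parK
  fun_prop

lemma ray_subst {α η x v : ℝ} (hα : 1 < α) (hv : 0 < v) :
    rayK (1 / α) (π * ((η - 1) / α + 1) / 2) x (v ^ α) (π * (1 - η) / 2) =
      Complex.I * Complex.exp (((-(π * η / 2) : ℝ) : ℂ) * Complex.I) * parK α η x v := by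
  have hα0 : α ≠ 0 := by positivity
  have h1 : 1 / α * (π * (1 - η) / 2) + π * ((η - 1) / α + 1) / 2 = π / 2 := by
    field_simp; ring
  have h2 : (v ^ α) ^ (1 / α) = v := by
    rw [← Real.rpow_mul hv.le, mul_one_div_cancel hα0, Real.rpow_one]
  have h3 : Complex.exp (((π / 2 : ℝ) : ℂ) * Complex.I) = Complex.I := by
    push_cast; exact Complex.exp_pi_div_two_mul_I
  have h4 : Complex.exp (((π * (1 - η) / 2 : ℝ) : ℂ) * Complex.I) =
      Complex.I * Complex.exp (((-(π * η / 2) : ℝ) : ℂ) * Complex.I) := by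
    conv_rhs => rw [← h3]
    rw [← Complex.exp_add]
    simp only [h3]
    congr 1
    push_cast; ring
  rw [rayK, h1, h2, h3, add_sub_assoc, Complex.exp_add, h4, parK]
  congr 2
  linear_combination ((x : ℂ) * ((v ^ α : ℝ) : ℂ) *
    Complex.exp (((-(π * η / 2) : ℝ) : ℂ) * Complex.I)) * Complex.I_mul_I

lemma parts {α η x : ℝ} (hα : 1 < α) (hη : |η| < 1) (hx : 0 < x) :
    (∫ r in Ioi (0:ℝ), rayK (1 / α) (π * ((η - 1) / α + 1) / 2) x r (π * (1 - η) / 2)).re =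
      x⁻¹ * (∫ v in Ioi (0:ℝ), parK α η x v).re := by
  have hα0 : 0 < α := by linarith
  have hc : 0 < x * Real.cos (π * η / 2) := mul_pos hx (cos_eta_pos hη)
  set κ : ℂ := Complex.exp (((-(π * η / 2) : ℝ) : ℂ) * Complex.I) with hκ
  have hcont := parK_cont hα0 η x
  have i0 : IntegrableOn (parK α η x) (Ioi 0) := by
    have h0 := integrableOn_rpow_mul_exp_neg_mul_rpow (s := 0) (by norm_num) hα0 hc
    simp only [Real.rpow_zero, one_mul] at h0
    refine Integrable.mono' h0 hcont.aestronglyMeasurable ?_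
    exact ae_of_all _ fun r => (parK_norm α η x r).le
  have i1 : IntegrableOn (fun v : ℝ => ((v ^ (α - 1) : ℝ) : ℂ) * parK α η x v) (Ioi 0) := by
    have h0 := integrableOn_rpow_mul_exp_neg_mul_rpow (s := α - 1) (by linarith) hα0 hc
    have hcr : Continuous (fun r : ℝ => r ^ (α - 1)) := Real.continuous_rpow_const (by linarith)
    refine Integrable.mono' h0
      ((Complex.continuous_ofReal.comp hcr).mul hcont).aestronglyMeasurable ?_
    filter_upwards [ae_restrict_mem measurableSet_Ioi] with r hr
    have hr' : (0:ℝ) < r := hr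
    rw [norm_mul, parK_norm, Complex.norm_real, Real.norm_eq_abs,
      abs_of_pos (Real.rpow_pos_of_pos hr' _)]
  have hxC : (x : ℂ) ≠ 0 := by exact_mod_cast hx.ne'
  have e1 : ∫ r in Ioi (0:ℝ), rayK (1 / α) (π * ((η - 1) / α + 1) / 2) x r (π * (1 - η) / 2) =
      ∫ v in Ioi (0:ℝ), (α * Complex.I * κ) * (((v ^ (α - 1) : ℝ) : ℂ) * parK α η x v) := by
    rw [← integral_comp_rpow_Ioi_of_pos hα0]
    refine setIntegral_congr_fun measurableSet_Ioi fun v hv => ?_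
    rw [ray_subst hα hv, Complex.real_smul, ← hκ]
    push_cast
    ring
  have hderiv : ∀ v ∈ Ioi (0:ℝ), HasDerivAt (fun v => -(Complex.I / x) * parK α η x v)
      ((α * Complex.I * κ) * (((v ^ (α - 1) : ℝ) : ℂ) * parK α η x v)
        - (x : ℂ)⁻¹ * parK α η x v) v := by
    intro v hv
    have h0 : HasDerivAt (fun r : ℝ => (r : ℂ)) 1 v := Complex.ofRealCLM.hasDerivAt
    have h1 : HasDerivAt (fun r : ℝ => ((r ^ α : ℝ) : ℂ)) ((α * v ^ (α - 1) : ℝ) : ℂ) v :=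
      (Real.hasDerivAt_rpow_const (Or.inl (ne_of_gt hv))).ofReal_comp
    have h2 := ((((h1.const_mul (x : ℂ)).mul_const κ).neg.sub
      (h0.const_mul Complex.I)).cexp).const_mul (-(Complex.I / x))
    refine HasDerivAt.congr_deriv (f := fun v => -(Complex.I / x) * parK α η x v) h2 ?_
    simp only [parK, Pi.sub_apply, Pi.neg_apply, ← hκ]
    push_cast
    field_simp
    ring_nf
    simp only [Complex.I_sq]
    ring
  have hlim : Filter.Tendsto (fun v => -(Complex.I / x) * parK α η x v) Filter.atTop (nhds 0) := by
    rw [← mul_zero (-(Complex.I / x))]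
    refine Filter.Tendsto.const_mul _ ?_
    rw [tendsto_zero_iff_norm_tendsto_zero]
    simp only [parK_norm]
    refine Real.tendsto_exp_atBot.comp ?_
    exact (tendsto_rpow_atTop hα0).const_mul_atTop_of_neg (by linarith)
  have e2 := integral_Ioi_of_hasDerivAt_of_tendsto (a := 0)
    (f := fun v => -(Complex.I / x) * parK α η x v)
    ((continuous_const.mul hcont).continuousWithinAt) hderiv
    ((i1.const_mul _).sub (i0.const_mul _)) hlim
  rw [integral_sub (i1.const_mul _) (i0.const_mul _), ← e1, integral_const_mul] at e2
  have e3 : parK α η x 0 = 1 := by simp [parK, Real.zero_rpow hα0.ne']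
  rw [e3, sub_eq_iff_eq_add] at e2
  rw [e2]
  have : (x : ℂ)⁻¹ = ((x⁻¹ : ℝ) : ℂ) := by push_cast; rfl
  rw [this, Complex.add_re, Complex.re_ofReal_mul]
  have : (0 - -(Complex.I / (x:ℂ)) * 1).re = 0 := by
    rw [div_eq_mul_inv, this]; simp
  rw [this, zero_add]

lemma par_scale {α η u : ℝ} (hu : 0 < u) :
    ∫ v in Ioi (0:ℝ), parK α η (u ^ (-α)) v = (u : ℂ) * ∫ l in Ioi (0:ℝ), halfK α η u l := by
  have h := integral_comp_mul_left_Ioi (parK α η (u ^ (-α))) 0 hu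
  rw [mul_zero, eq_inv_smul_iff₀ hu.ne'] at h
  rw [← h, Complex.real_smul]
  congr 1
  refine setIntegral_congr_fun measurableSet_Ioi fun l hl => ?_
  have hl' : (0:ℝ) < l := hl
  have : ((u ^ (-α) : ℝ) : ℂ) * (((u * l) ^ α : ℝ) : ℂ) = ((l ^ α : ℝ) : ℂ) := by
    rw [← Complex.ofReal_mul, Real.mul_rpow hu.le hl'.le, ← mul_assoc, ← Real.rpow_add hu]
    simp
  simp only [parK, halfK, this]
  congr 1
  push_cast
  ring

/-- Zolotarev duality. -/
theorem zolotarev_duality (α η : ℝ) (hα1 : 1 < α) (hα2 : α ≤ 2) (hη : |η| ≤ 2 - α) :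
    ∀ u : ℝ, 0 < u →
      zolDensity α η 1 u =
        u ^ (-(1 + α)) * zolDensity (1 / α) ((η - 1) / α + 1) 1 (u ^ (-α)) := by
  intro u hu
  have hα0 : 0 < α := by linarith
  have hη1 : |η| < 1 := by linarith
  obtain ⟨ha, hb⟩ := abs_le.1 hη
  have hs : (η - 1) / α + 1 = (η - 1 + α) / α := by field_simp
  have hη' : |(η - 1) / α + 1| < 1 := by
    rw [hs, abs_lt, lt_div_iff₀ hα0, div_lt_iff₀ hα0]
    constructor <;> linarith
  have hη'' := abs_lt.1 hη'
  have hx : 0 < u ^ (-α) := Real.rpow_pos_of_pos hu _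
  have hpi := Real.pi_pos
  rw [zol_half hα0 hη1, zol_half (by positivity) hη', conj_halfK (1 / α),
    ← ray_rotation (θ := π * (1 - η) / 2) (by positivity) ?_ hx ?_ ?_ ?_ ?_, parts hα1 hη1 hx,
    par_scale hu, Complex.re_ofReal_mul]
  · have : u ^ (-(1 + α)) * ((u ^ (-α))⁻¹ * u) = 1 := by
      rw [← Real.rpow_neg hu.le, neg_neg]
      nth_rewrite 3 [← Real.rpow_one u]
      rw [← Real.rpow_add hu, ← Real.rpow_add hu]
      ring_nf
      simp
    linear_combination (-(1 / π) * (∫ l in Ioi (0:ℝ), halfK α η u l).re) * this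
  · rw [div_le_one hα0]; exact hα1.le
  · nlinarith
  · nlinarith
  · nlinarith
  · field_simp
    ring
end

section
/- Let 1 < α ≤ 2, b > 0, and for t > 0 let P(x,t) = p_α(x; 2−α, b^{−α} t) be the density of a totally negatively skewed stable Lévy motion at time t. Then ∫_0^∞ P(x,t) dx = 1/α for all t > 0. -/
open MeasureTheory Real Set

open Filter Topology

/-! ### The integral of `e^{-au} sin(cu)/u` -/

lemma aux_cos_integral {a : ℝ} (ha : 0 < a) (y : ℝ) :
    ∫ u in Ioi (0 : ℝ), Real.exp (-a * u) * Real.cos (y * u) = a / (a ^ 2 + y ^ 2) := by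
  have hre : ((-a : ℂ) + y * Complex.I).re < 0 := by simp [ha]
  have h1 := integral_exp_mul_complex_Ioi hre 0
  have h2 := integrableOn_exp_mul_complex_Ioi hre 0
  have h3 : ∀ u : ℝ, Real.exp (-a * u) * Real.cos (y * u)
      = RCLike.re (Complex.exp (((-a : ℂ) + y * Complex.I) * u)) := by
    intro u
    simp [Complex.exp_re]
  simp_rw [h3]
  rw [integral_re h2, h1]
  simp [Complex.div_re, Complex.normSq_apply]
  rw [← pow_two, ← pow_two]

lemma aux_sin_div_bound {a c u : ℝ} (hu : 0 < u) :
    ‖Real.exp (-a * u) * Real.sin (c * u) / u‖ ≤ |c| * Real.exp (-a * u) := by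
  rw [norm_div, norm_mul, Real.norm_of_nonneg (Real.exp_pos _).le, Real.norm_of_nonneg hu.le,
    div_le_iff₀ hu, Real.norm_eq_abs]
  have : |Real.sin (c * u)| ≤ |c| * u := by
    have := Real.abs_sin_le_abs (x := c * u)
    rwa [abs_mul, abs_of_pos hu] at this
  nlinarith [Real.exp_pos (-a * u)]

lemma aux_exp_int {a : ℝ} (ha : 0 < a) :
    IntegrableOn (fun u : ℝ => Real.exp (-a * u)) (Ioi 0) :=
  integrableOn_exp_mul_Ioi (by linarith) 0

lemma aux_sin_div_int {a : ℝ} (ha : 0 < a) (c : ℝ) :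
    IntegrableOn (fun u : ℝ => Real.exp (-a * u) * Real.sin (c * u) / u) (Ioi 0) := by
  refine Integrable.mono' ((aux_exp_int ha).const_mul |c|) ?_ ?_
  · exact Measurable.aestronglyMeasurable (by fun_prop)
  · filter_upwards [ae_restrict_mem measurableSet_Ioi] with u hu
    exact aux_sin_div_bound hu

lemma aux_sin_div_integral {a c : ℝ} (ha : 0 < a) (hc : 0 ≤ c) :
    ∫ u in Ioi (0 : ℝ), Real.exp (-a * u) * Real.sin (c * u) / u = Real.arctan (c / a) := by
  have h1 : ∀ u ∈ Ioi (0 : ℝ), Real.exp (-a * u) * Real.sin (c * u) / u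
      = ∫ y in Ioc 0 c, Real.exp (-a * u) * Real.cos (y * u) := by
    intro u hu
    have hu' : u ≠ 0 := (mem_Ioi.1 hu).ne'
    rw [← intervalIntegral.integral_of_le hc, intervalIntegral.integral_const_mul,
      intervalIntegral.integral_comp_mul_right _ hu', integral_cos]
    simp
    field_simp
  rw [setIntegral_congr_fun measurableSet_Ioi h1, integral_integral_swap]
  · simp_rw [aux_cos_integral ha]
    rw [← intervalIntegral.integral_of_le hc]
    have hd : ∀ y ∈ uIcc 0 c, HasDerivAt (fun y => Real.arctan (y / a)) (a / (a ^ 2 + y ^ 2)) y := by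
      intro y _
      have := ((hasDerivAt_id y).div_const a).arctan
      refine HasDerivAt.congr_deriv (f := fun y => Real.arctan (y / a)) this ?_
      change 1 / (1 + (y / a) ^ 2) * (1 / a) = _
      field_simp
    rw [intervalIntegral.integral_eq_sub_of_hasDerivAt hd]
    · simp
    · apply Continuous.intervalIntegrable
      exact continuous_const.div (by fun_prop) (fun y => by positivity)
  · have hg : Integrable (fun p : ℝ × ℝ => Real.exp (-a * p.1) * 1)
        ((volume.restrict (Ioi 0)).prod (volume.restrict (Ioc 0 c))) :=
      Integrable.mul_prod (f := fun u => Real.exp (-a * u)) (g := fun _ => (1 : ℝ))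
        (aux_exp_int ha) (integrable_const _)
    refine hg.mono' (Continuous.aestronglyMeasurable (by fun_prop)) ?_
    refine Eventually.of_forall fun p => ?_
    simp only [Function.uncurry]
    rw [norm_mul, Real.norm_of_nonneg (Real.exp_pos _).le, Real.norm_eq_abs]
    gcongr
    exact Real.abs_cos_le_one _

/-! ### Contour rotation -/

/-- The integrand along the ray of angle `θ`. -/
noncomputable def rayF (α B x θ r : ℝ) : ℂ :=
  Complex.exp (θ * Complex.I) * Complex.exp (-((r * x : ℝ) : ℂ) * Complex.exp (θ * Complex.I) +
    ((B * r ^ α : ℝ) : ℂ) * Complex.exp ((α * θ : ℝ) * Complex.I))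

noncomputable def rayF' (α B x θ r : ℝ) : ℂ :=
  Complex.I * (1 - ((r * x : ℝ) : ℂ) * Complex.exp (θ * Complex.I) +
    (α : ℂ) * ((B * r ^ α : ℝ) : ℂ) * Complex.exp ((α * θ : ℝ) * Complex.I)) * rayF α B x θ r

lemma rayF_norm (α B x θ r : ℝ) :
    ‖rayF α B x θ r‖ = Real.exp (-(r * x * Real.cos θ) + B * r ^ α * Real.cos (α * θ)) := by
  unfold rayF
  rw [norm_mul, Complex.norm_exp_ofReal_mul_I, one_mul, Complex.norm_exp]
  congr 1
  rw [Complex.add_re, ← Complex.ofReal_neg, Complex.re_ofReal_mul, Complex.re_ofReal_mul,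
    Complex.exp_ofReal_mul_I_re, Complex.exp_ofReal_mul_I_re]
  ring

lemma rayF_bound {α B x θ r c : ℝ} (hB : 0 < B) (hx : 0 ≤ x) (hr : 0 ≤ r)
    (hθ : 0 ≤ Real.cos θ) (hc : Real.cos (α * θ) ≤ -c) :
    ‖rayF α B x θ r‖ ≤ Real.exp (-(B * c) * r ^ α) := by
  rw [rayF_norm]
  apply Real.exp_le_exp.2
  have h1 : 0 ≤ r * x * Real.cos θ := by positivity
  have h2 : 0 ≤ B * r ^ α := by positivity
  nlinarith

lemma rayF'_bound {α B x θ r c : ℝ} (hα : 0 < α) (hB : 0 < B) (hx : 0 ≤ x) (hr : 0 ≤ r)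
    (hθ : 0 ≤ Real.cos θ) (hc : Real.cos (α * θ) ≤ -c) :
    ‖rayF' α B x θ r‖ ≤ (1 + r * x + α * (B * r ^ α)) * Real.exp (-(B * c) * r ^ α) := by
  unfold rayF'
  rw [norm_mul, norm_mul, Complex.norm_I, one_mul]
  have h2 : 0 ≤ B * r ^ α := by positivity
  have h3 : 0 ≤ r * x := by positivity
  refine mul_le_mul ?_ (rayF_bound hB hx hr hθ hc) (norm_nonneg _) (by positivity)
  refine (norm_add_le _ _).trans (add_le_add ((norm_sub_le _ _).trans (add_le_add ?_ ?_)) ?_)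
  · simp
  · rw [norm_mul, Complex.norm_exp_ofReal_mul_I, mul_one, Complex.norm_real,
      Real.norm_of_nonneg h3]
  · rw [norm_mul, norm_mul, Complex.norm_exp_ofReal_mul_I, mul_one, Complex.norm_real,
      Complex.norm_real, Real.norm_of_nonneg h2, Real.norm_of_nonneg hα.le]

lemma rayF_hasDerivAt_angle (α B x r θ : ℝ) :
    HasDerivAt (fun θ => rayF α B x θ r) (rayF' α B x θ r) θ := by
  have e1 : HasDerivAt (fun θ : ℝ => Complex.exp (θ * Complex.I))
      (Complex.exp (θ * Complex.I) * (1 * Complex.I)) θ :=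
    ((Complex.ofRealCLM.hasDerivAt (x := θ)).mul_const Complex.I).cexp
  have e2 : HasDerivAt (fun θ : ℝ => Complex.exp ((α * θ : ℝ) * Complex.I))
      (Complex.exp ((α * θ : ℝ) * Complex.I) * (((α * 1 : ℝ) : ℂ) * Complex.I)) θ :=
    ((((hasDerivAt_id θ).const_mul α).ofReal_comp).mul_const Complex.I).cexp
  have e3 := e1.mul (((e1.const_mul (-((r * x : ℝ) : ℂ))).add
    (e2.const_mul ((B * r ^ α : ℝ) : ℂ))).cexp)
  refine e3.congr_deriv ?_
  unfold rayF' rayF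
  simp only [Pi.add_apply]
  push_cast
  ring

lemma rayF_hasDerivAt_radius {α B x r θ : ℝ} (hr : 0 < r) :
    HasDerivAt (fun r : ℝ => Complex.I * (r : ℂ) * rayF α B x θ r) (rayF' α B x θ r) r := by
  have e0 : HasDerivAt (fun r : ℝ => Complex.I * (r : ℂ)) (Complex.I * 1) r :=
    (Complex.ofRealCLM.hasDerivAt (x := r)).const_mul Complex.I
  have e1 : HasDerivAt (fun r : ℝ => ((r * x : ℝ) : ℂ)) ((1 * x : ℝ) : ℂ) r :=
    ((hasDerivAt_id r).mul_const x).ofReal_comp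
  have e2 : HasDerivAt (fun r : ℝ => ((B * r ^ α : ℝ) : ℂ)) ((B * (α * r ^ (α - 1)) : ℝ) : ℂ) r :=
    ((Real.hasDerivAt_rpow_const (Or.inl hr.ne')).const_mul B).ofReal_comp
  have e3 := e0.mul ((((e1.neg.mul_const (Complex.exp (θ * Complex.I))).add
    (e2.mul_const (Complex.exp ((α * θ : ℝ) * Complex.I)))).cexp).const_mul
      (Complex.exp (θ * Complex.I)))
  refine e3.congr_deriv ?_
  have hp : r ^ (α - 1) = r ^ α / r := by rw [Real.rpow_sub_one hr.ne']
  have hrc : (r : ℂ) ≠ 0 := by exact_mod_cast hr.ne'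
  unfold rayF' rayF
  rw [hp]
  simp only [Pi.add_apply, Pi.neg_apply]
  push_cast
  field_simp
  ring

lemma rayF_continuous_radius {α B x θ : ℝ} (hα : 0 < α) :
    Continuous (fun r : ℝ => rayF α B x θ r) := by
  unfold rayF
  have : Continuous (fun r : ℝ => r ^ α) := Real.continuous_rpow_const hα.le
  fun_prop

lemma rayF'_continuous_radius {α B x θ : ℝ} (hα : 0 < α) :
    Continuous (fun r : ℝ => rayF' α B x θ r) := by
  unfold rayF'
  have : Continuous (fun r : ℝ => r ^ α) := Real.continuous_rpow_const hα.le
  have := rayF_continuous_radius (B := B) (x := x) (θ := θ) hα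
  fun_prop

lemma bound0_int {α k : ℝ} (hα : 0 < α) (hk : 0 < k) :
    IntegrableOn (fun r : ℝ => Real.exp (-k * r ^ α)) (Ioi 0) := by
  have := integrableOn_rpow_mul_exp_neg_mul_rpow (p := α) (s := 0) (b := k) (by norm_num) hα hk
  simpa using this

lemma bound1_int {α B x k : ℝ} (hα : 0 < α) (hk : 0 < k) :
    IntegrableOn (fun r : ℝ => (1 + r * x + α * (B * r ^ α)) * Real.exp (-k * r ^ α)) (Ioi 0) := by
  have h0 := bound0_int hα hk
  have h1 := integrableOn_rpow_mul_exp_neg_mul_rpow (p := α) (s := 1) (b := k) (by norm_num) hα hk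
  have h2 := integrableOn_rpow_mul_exp_neg_mul_rpow (p := α) (s := α) (b := k) (by linarith) hα hk
  have := (h0.add (h1.const_mul x)).add (h2.const_mul (α * B))
  refine this.congr (Eventually.of_forall fun r => ?_)
  simp only [Pi.add_apply, Real.rpow_one]
  ring

lemma ray_tendsto_s1 {α B x θ k : ℝ} (hα : 0 < α) (hB : 0 < B) (hx : 0 ≤ x) (hk : 0 < k)
    (hθ : 0 ≤ Real.cos θ) (hc : Real.cos (α * θ) ≤ -k) :
    Tendsto (fun r : ℝ => Complex.I * (r : ℂ) * rayF α B x θ r) atTop (𝓝 0) := by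
  have h1 : Tendsto (fun u : ℝ => u ^ (1 / α) * Real.exp (-(B * k) * u)) atTop (𝓝 0) :=
    tendsto_rpow_mul_exp_neg_mul_atTop_nhds_zero _ _ (by positivity)
  have h2 := h1.comp (tendsto_rpow_atTop hα)
  refine squeeze_zero_norm' ?_ h2
  filter_upwards [eventually_gt_atTop 0] with r hr
  rw [norm_mul, norm_mul, Complex.norm_I, one_mul, Complex.norm_real, Real.norm_of_nonneg hr.le]
  simp only [Function.comp]
  rw [← Real.rpow_mul hr.le, mul_one_div_cancel hα.ne', Real.rpow_one]
  exact mul_le_mul_of_nonneg_left (rayF_bound hB hx hr.le hθ hc) hr.le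

lemma rayF_integrable {α B x θ k : ℝ} (hα : 0 < α) (hB : 0 < B) (hx : 0 ≤ x) (hk : 0 < k)
    (hθ : 0 ≤ Real.cos θ) (hc : Real.cos (α * θ) ≤ -k) :
    IntegrableOn (fun r : ℝ => rayF α B x θ r) (Ioi 0) := by
  refine Integrable.mono' (bound0_int hα (mul_pos hB hk))
    (rayF_continuous_radius hα).aestronglyMeasurable ?_
  filter_upwards [ae_restrict_mem measurableSet_Ioi] with r hr
  exact rayF_bound hB hx (le_of_lt hr) hθ hc

lemma rayF'_integral {α B x θ k : ℝ} (hα : 0 < α) (hB : 0 < B) (hx : 0 ≤ x) (hk : 0 < k)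
    (hθ : 0 ≤ Real.cos θ) (hc : Real.cos (α * θ) ≤ -k) :
    ∫ r in Ioi (0 : ℝ), rayF' α B x θ r = 0 := by
  have hint : IntegrableOn (fun r : ℝ => rayF' α B x θ r) (Ioi 0) := by
    refine Integrable.mono' (bound1_int (B := B) (x := x) hα (mul_pos hB hk))
      (rayF'_continuous_radius hα).aestronglyMeasurable ?_
    filter_upwards [ae_restrict_mem measurableSet_Ioi] with r hr
    exact rayF'_bound hα hB hx (le_of_lt hr) hθ hc
  rw [integral_Ioi_of_hasDerivAt_of_tendsto (f := fun r : ℝ => Complex.I * (r : ℂ) * rayF α B x θ r)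
    (m := 0) ?_ (fun r hr => rayF_hasDerivAt_radius hr) hint (ray_tendsto_s1 hα hB hx hk hθ hc)]
  · simp
  · have := rayF_continuous_radius (B := B) (x := x) (θ := θ) hα
    exact Continuous.continuousWithinAt (by fun_prop)

lemma ray_rotate {α B x θ₁ θ₀ k : ℝ} (hα : 0 < α) (hB : 0 < B) (hx : 0 ≤ x) (hk : 0 < k)
    (h1 : θ₁ < θ₀) (h2 : θ₀ < π / 2)
    (hθ : ∀ θ ∈ Icc θ₁ (π / 2), 0 ≤ Real.cos θ ∧ Real.cos (α * θ) ≤ -k) :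
    ∫ r in Ioi (0 : ℝ), rayF α B x (π / 2) r = ∫ r in Ioi (0 : ℝ), rayF α B x θ₀ r := by
  have hcont : ContinuousOn (fun θ => ∫ r in Ioi (0 : ℝ), rayF α B x θ r) (Icc θ₀ (π / 2)) := by
    refine continuousOn_of_dominated (bound := fun r => Real.exp (-(B * k) * r ^ α)) ?_ ?_
      (bound0_int hα (mul_pos hB hk)) ?_
    · intro θ _
      exact (rayF_continuous_radius hα).aestronglyMeasurable
    · intro θ ht
      filter_upwards [ae_restrict_mem measurableSet_Ioi] with r hr
      have := hθ θ ⟨h1.le.trans ht.1, ht.2⟩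
      exact rayF_bound hB hx (le_of_lt hr) this.1 this.2
    · refine Eventually.of_forall fun r => ?_
      intro θ _
      exact (rayF_hasDerivAt_angle α B x r θ).continuousAt.continuousWithinAt
  refine constant_of_has_deriv_right_zero hcont ?_ _ ⟨h2.le, le_rfl⟩
  intro θ ht
  have hmem : θ ∈ Icc θ₁ (π / 2) := ⟨h1.le.trans ht.1, ht.2.le⟩
  have := hasDerivAt_integral_of_dominated_loc_of_deriv_le (μ := volume.restrict (Ioi (0 : ℝ)))
    (F := fun θ r => rayF α B x θ r) (F' := fun θ r => rayF' α B x θ r) (x₀ := θ)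
    (bound := fun r => (1 + r * x + α * (B * r ^ α)) * Real.exp (-(B * k) * r ^ α))
    (s := Ioo θ₁ (π / 2)) (Ioo_mem_nhds (h1.trans_le ht.1) ht.2)
    (Eventually.of_forall fun _ => (rayF_continuous_radius hα).aestronglyMeasurable)
    (rayF_integrable hα hB hx hk (hθ θ hmem).1 (hθ θ hmem).2)
    (rayF'_continuous_radius hα).aestronglyMeasurable
    (by
      filter_upwards [ae_restrict_mem measurableSet_Ioi] with r hr θ' hθ'
      have := hθ θ' ⟨hθ'.1.le, hθ'.2.le⟩
      exact rayF'_bound hα hB hx (le_of_lt hr) this.1 this.2)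
    (bound1_int hα (mul_pos hB hk))
    (Eventually.of_forall fun r θ' _ => rayF_hasDerivAt_angle α B x r θ')
  have h := this.2
  rw [rayF'_integral hα hB hx hk (hθ θ hmem).1 (hθ θ hmem).2] at h
  exact h.hasDerivWithinAt

/-! ### The density as a ray integral -/

lemma zol_eq_ray {α B x k : ℝ} (hα : 0 < α) (hB : 0 < B) (hx : 0 ≤ x) (hk : 0 < k)
    (hc : Real.cos (α * (π / 2)) ≤ -k) :
    zolDensity α (2 - α) B x = (1 / π) * (∫ r in Ioi (0 : ℝ), rayF α B x (π / 2) r).im := by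
  unfold zolDensity
  set h : ℝ → ℂ := fun l => Complex.exp (-Complex.I * (l : ℂ) * (x : ℂ)) *
        Complex.exp (-(B : ℂ) * ((|l| ^ α : ℝ) : ℂ) *
          Complex.exp (-Complex.I * (Real.pi : ℂ) * ((2 - α : ℝ) : ℂ) *
            ((Real.sign l : ℝ) : ℂ) / 2)) with hh
  have hI : Complex.exp (((π / 2 : ℝ) : ℂ) * Complex.I) = Complex.I := by
    push_cast; exact Complex.exp_pi_div_two_mul_I
  have e1 : Complex.exp (-Complex.I * (Real.pi : ℂ) * ((2 - α : ℝ) : ℂ) * ((1 : ℝ) : ℂ) / 2)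
      = - Complex.exp ((α * (π / 2) : ℝ) * Complex.I) := by
    rw [show (-Complex.I * (Real.pi : ℂ) * ((2 - α : ℝ) : ℂ) * ((1 : ℝ) : ℂ) / 2)
      = (α * (π / 2) : ℝ) * Complex.I - π * Complex.I by push_cast; ring,
      Complex.exp_sub, Complex.exp_pi_mul_I]
    ring
  have e2 : Complex.exp (-Complex.I * (Real.pi : ℂ) * ((2 - α : ℝ) : ℂ) * ((-1 : ℝ) : ℂ) / 2)
      = - Complex.exp (-((α * (π / 2) : ℝ) * Complex.I)) := by
    rw [show (-Complex.I * (Real.pi : ℂ) * ((2 - α : ℝ) : ℂ) * ((-1 : ℝ) : ℂ) / 2)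
      = -((α * (π / 2) : ℝ) * Complex.I) + π * Complex.I by push_cast; ring,
      Complex.exp_add, Complex.exp_pi_mul_I]
    ring
  have hpos : ∀ l : ℝ, 0 < l → h l = -Complex.I * rayF α B x (π / 2) l := by
    intro l hl
    simp only [hh]
    unfold rayF
    rw [Real.sign_of_pos hl, e1, hI, abs_of_pos hl, ← Complex.exp_add, ← mul_assoc]
    simp only [neg_mul, Complex.I_mul_I, neg_neg, one_mul]
    congr 1
    push_cast
    ring
  have hneg : ∀ l : ℝ, l < 0 → h l = (starRingEnd ℂ) (-Complex.I * rayF α B x (π / 2) (-l)) := by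
    intro l hl
    simp only [hh]
    unfold rayF
    rw [Real.sign_of_neg hl, e2, hI, abs_of_neg hl, ← Complex.exp_add, ← mul_assoc]
    simp only [neg_mul, Complex.I_mul_I, neg_neg, one_mul]
    rw [← Complex.exp_conj]
    congr 1
    simp only [map_add, map_neg, map_mul, Complex.conj_ofReal, Complex.conj_I, ← Complex.exp_conj]
    push_cast
    rw [mul_neg]
    ring
  have hray : IntegrableOn (fun r : ℝ => rayF α B x (π / 2) r) (Ioi 0) :=
    rayF_integrable hα hB hx hk (by simp) hc
  have hip : IntegrableOn h (Ioi 0) := by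
    refine IntegrableOn.congr_fun (hray.const_mul (-Complex.I)) ?_ measurableSet_Ioi
    intro l hl
    exact (hpos l hl).symm
  have hin : IntegrableOn h (Iio 0) := by
    have h1 : IntegrableOn (fun r : ℝ => rayF α B x (π / 2) (-r)) (Iio 0) := by
      have := IntegrableOn.comp_neg_Iio (c := 0) (f := fun r : ℝ => rayF α B x (π / 2) r)
        (by simpa using hray)
      exact this
    have h2 : IntegrableOn (fun r : ℝ =>
        (starRingEnd ℂ) (-Complex.I * rayF α B x (π / 2) (-r))) (Iio 0) := by
      have := Complex.conjCLE.toContinuousLinearMap.integrable_comp (h1.const_mul (-Complex.I))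
      exact this
    refine IntegrableOn.congr_fun h2 ?_ measurableSet_Iio
    intro l hl
    exact (hneg l hl).symm
  have hint : Integrable h := by
    rw [← integrableOn_univ, ← Iic_union_Ioi (a := (0 : ℝ))]
    exact ((integrableOn_Iic_iff_integrableOn_Iio (by simp)).2 hin).union hip
  have hre : (∫ l, h l).re = ∫ l, (h l).re := (integral_re hint).symm
  have him : (∫ r in Ioi (0 : ℝ), rayF α B x (π / 2) r).im
      = ∫ r in Ioi (0 : ℝ), (rayF α B x (π / 2) r).im := (integral_im hray).symm
  have habs : ∫ l, (h l).re = ∫ l, (fun r => (rayF α B x (π / 2) r).im) |l| := by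
    apply integral_congr_ae
    have : ∀ᵐ l : ℝ, l ≠ 0 := by simp [ae_iff, measure_singleton]
    filter_upwards [this] with l hl
    rcases lt_or_gt_of_ne hl with hl | hl
    · rw [hneg l hl, abs_of_neg hl]; simp
    · rw [hpos l hl, abs_of_pos hl]; simp
  rw [hre, habs, integral_comp_abs (f := fun r => (rayF α B x (π / 2) r).im), him]
  field_simp

/-! ### Subtraction of a term with real integral -/

/-- Difference of the two exponentials. -/
noncomputable def dF (α B θ r : ℝ) : ℂ :=
  Complex.exp (((B * r ^ α : ℝ) : ℂ) * Complex.exp ((α * θ : ℝ) * Complex.I)) -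
    Complex.exp (-(r : ℂ) * Complex.exp (θ * Complex.I))

/-- The subtracted integrand. -/
noncomputable def sF (α B θ x r : ℝ) : ℂ :=
  Complex.exp (θ * Complex.I) * Complex.exp (-(r : ℂ) * Complex.exp (θ * Complex.I) * x)
    * dF α B θ r

lemma exp_ray_re (θ s : ℝ) : (-Complex.exp (θ * Complex.I) * s).re = -(Real.cos θ * s) := by
  rw [Complex.re_mul_ofReal, Complex.neg_re, Complex.exp_ofReal_mul_I_re]; ring

lemma ray_sub {α B x θ k : ℝ} (hα : 0 < α) (hB : 0 < B) (hx : 0 ≤ x) (hk : 0 < k)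
    (hθ : 0 < Real.cos θ) (hc : Real.cos (α * θ) ≤ -k) :
    (∫ r in Ioi (0 : ℝ), rayF α B x θ r).im = (∫ r in Ioi (0 : ℝ), sF α B θ x r).im := by
  have hre : (-Complex.exp (θ * Complex.I) * ((x + 1 : ℝ) : ℂ)).re < 0 := by
    rw [exp_ray_re]; nlinarith
  have h1 := integrableOn_exp_mul_complex_Ioi hre 0
  have h2 := integral_exp_mul_complex_Ioi hre 0
  have h3 : ∀ r : ℝ, sF α B θ x r = rayF α B x θ r - Complex.exp (θ * Complex.I) *
      Complex.exp (-Complex.exp (θ * Complex.I) * ((x + 1 : ℝ) : ℂ) * r) := by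
    intro r
    unfold sF dF rayF
    rw [mul_sub]
    simp only [mul_assoc, ← Complex.exp_add]
    congr 2 <;> push_cast <;> ring
  simp_rw [h3]
  rw [integral_sub (rayF_integrable hα hB hx hk hθ.le hc) (h1.const_mul _), integral_const_mul, h2,
    Complex.sub_im]
  have hx1 : ((x + 1 : ℝ) : ℂ) ≠ 0 := by
    have : x + 1 ≠ 0 := by linarith
    exact_mod_cast this
  have : Complex.exp (θ * Complex.I) * (-Complex.exp (-Complex.exp (θ * Complex.I) *
      ((x + 1 : ℝ) : ℂ) * (0 : ℝ)) / (-Complex.exp (θ * Complex.I) * ((x + 1 : ℝ) : ℂ)))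
      = (((x + 1)⁻¹ : ℝ) : ℂ) := by
    have := Complex.exp_ne_zero (θ * Complex.I)
    rw [Complex.ofReal_inv]
    simp only [Complex.ofReal_zero, mul_zero, Complex.exp_zero]
    field_simp
  rw [this, Complex.ofReal_im, sub_zero]

/-! ### Fubini -/

lemma dF_measurable (α B θ : ℝ) : Measurable (dF α B θ) := by
  unfold dF
  fun_prop

lemma sF_inner {α B θ r : ℝ} (hθ : 0 < Real.cos θ) (hr : 0 < r) :
    ∫ x in Ioi (0 : ℝ), sF α B θ x r = dF α B θ r / r := by
  have hre : (-Complex.exp (θ * Complex.I) * (r : ℂ)).re < 0 := by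
    rw [exp_ray_re]; nlinarith
  have h2 := integral_exp_mul_complex_Ioi hre 0
  have h3 : ∀ x : ℝ, sF α B θ x r = Complex.exp (θ * Complex.I) *
      Complex.exp (-Complex.exp (θ * Complex.I) * (r : ℂ) * x) * dF α B θ r := by
    intro x
    unfold sF
    congr 3
    ring
  simp_rw [h3]
  rw [integral_mul_const, integral_const_mul, h2]
  have := Complex.exp_ne_zero (θ * Complex.I)
  have hr' : (r : ℂ) ≠ 0 := by exact_mod_cast hr.ne'
  simp only [Complex.ofReal_zero, mul_zero, Complex.exp_zero]
  field_simp

lemma sF_norm (α B θ x r : ℝ) :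
    ‖sF α B θ x r‖ = Real.exp (-(Real.cos θ * r) * x) * ‖dF α B θ r‖ := by
  unfold sF
  rw [norm_mul, norm_mul, Complex.norm_exp_ofReal_mul_I, one_mul, Complex.norm_exp]
  congr 2
  rw [show -(r : ℂ) * Complex.exp (θ * Complex.I) * x
    = -Complex.exp (θ * Complex.I) * ((r * x : ℝ) : ℂ) by push_cast; ring, exp_ray_re]
  ring

lemma exp_sub_one_bound (z : ℂ) : ‖Complex.exp z - 1‖ ≤ ‖z‖ * Real.exp ‖z‖ := by
  have := Complex.norm_exp_sub_sum_le_norm_mul_exp z 1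
  simpa using this

lemma dF_div_int {α B θ k : ℝ} (hα : 1 < α) (hB : 0 < B) (hk : 0 < k)
    (hθ : 0 < Real.cos θ) (hc : Real.cos (α * θ) ≤ -k) :
    IntegrableOn (fun r : ℝ => ‖dF α B θ r‖ / r) (Ioi 0) := by
  have hmeas : Measurable (fun r : ℝ => ‖dF α B θ r‖ / r) :=
    (dF_measurable α B θ).norm.div measurable_id
  rw [← Ioc_union_Ioi_eq_Ioi (zero_le_one (α := ℝ))]
  refine IntegrableOn.union ?_ ?_
  · refine Integrable.mono' (g := fun _ => B * Real.exp B + Real.exp 1)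
      (integrableOn_const (by simp)) hmeas.aestronglyMeasurable ?_
    filter_upwards [ae_restrict_mem measurableSet_Ioc] with r hr
    have hr0 := hr.1
    rw [norm_div, norm_norm, Real.norm_of_nonneg hr0.le, div_le_iff₀ hr0]
    have hra : r ^ α ≤ r := by
      simpa using Real.rpow_le_rpow_of_exponent_ge hr0 hr.2 hα.le
    have hra0 : 0 ≤ r ^ α := by positivity
    unfold dF
    have b1 := exp_sub_one_bound (((B * r ^ α : ℝ) : ℂ) * Complex.exp ((α * θ : ℝ) * Complex.I))
    have b2 := exp_sub_one_bound (-(r : ℂ) * Complex.exp (θ * Complex.I))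
    rw [norm_mul, Complex.norm_exp_ofReal_mul_I, mul_one, Complex.norm_real,
      Real.norm_of_nonneg (by positivity)] at b1
    rw [norm_mul, Complex.norm_exp_ofReal_mul_I, mul_one, norm_neg, Complex.norm_real,
      Real.norm_of_nonneg hr0.le] at b2
    have c1 : B * r ^ α * Real.exp (B * r ^ α) ≤ B * r * Real.exp B := by
      have : B * r ^ α ≤ B := by nlinarith [hr.2]
      gcongr
    have c2 : r * Real.exp r ≤ r * Real.exp 1 := by
      have := hr.2
      gcongr
    calc _ = ‖(Complex.exp (((B * r ^ α : ℝ) : ℂ) * Complex.exp ((α * θ : ℝ) * Complex.I)) - 1) -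
          (Complex.exp (-(r : ℂ) * Complex.exp (θ * Complex.I)) - 1)‖ := by congr 1; ring
      _ ≤ _ := norm_sub_le _ _
      _ ≤ B * r * Real.exp B + r * Real.exp 1 := by linarith
      _ = _ := by ring
  · have hg : IntegrableOn (fun r : ℝ => Real.exp (-(B * k) * r ^ α) + Real.exp (-Real.cos θ * r))
        (Ioi 1) :=
      ((bound0_int (by linarith) (mul_pos hB hk)).add (aux_exp_int hθ)).mono_set
        (Ioi_subset_Ioi zero_le_one)
    refine Integrable.mono' hg hmeas.aestronglyMeasurable ?_
    filter_upwards [ae_restrict_mem measurableSet_Ioi] with r hr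
    have hr1 : 1 < r := hr
    have hr0 : 0 < r := by linarith
    rw [norm_div, norm_norm, Real.norm_of_nonneg hr0.le]
    refine (div_le_self (norm_nonneg _) hr1.le).trans ?_
    unfold dF
    refine (norm_sub_le _ _).trans (add_le_add ?_ ?_)
    · rw [Complex.norm_exp, Complex.re_ofReal_mul, Complex.exp_ofReal_mul_I_re]
      apply Real.exp_le_exp.2
      have h2 : 0 ≤ B * r ^ α := by positivity
      nlinarith
    · rw [Complex.norm_exp, ← Complex.ofReal_neg, Complex.re_ofReal_mul,
        Complex.exp_ofReal_mul_I_re]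
      apply Real.exp_le_exp.2
      linarith

lemma sF_prod_int {α B θ k : ℝ} (hα : 1 < α) (hB : 0 < B) (hk : 0 < k)
    (hθ : 0 < Real.cos θ) (hc : Real.cos (α * θ) ≤ -k) :
    Integrable (Function.uncurry (sF α B θ))
      ((volume.restrict (Ioi 0)).prod (volume.restrict (Ioi 0))) := by
  have hm : Measurable (Function.uncurry (sF α B θ)) := by
    have := dF_measurable α B θ
    unfold Function.uncurry sF
    fun_prop
  rw [integrable_prod_iff' hm.aestronglyMeasurable]
  constructor
  · filter_upwards [ae_restrict_mem measurableSet_Ioi] with r hr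
    have hr0 : 0 < r := hr
    refine Integrable.mono' ((aux_exp_int (mul_pos hθ hr0)).mul_const ‖dF α B θ r‖)
      (hm.of_uncurry_right (y := r)).aestronglyMeasurable (Eventually.of_forall fun x => ?_)
    exact (sF_norm α B θ x r).le
  · have := (dF_div_int hα hB hk hθ hc).const_mul (Real.cos θ)⁻¹
    refine IntegrableOn.congr_fun this ?_ measurableSet_Ioi
    intro r hr
    have hr0 : 0 < r := hr
    simp only [Function.uncurry, sF_norm]
    rw [integral_mul_const, integral_exp_mul_Ioi (by nlinarith)]
    simp
    field_simp

lemma sF_fubini {α B θ k : ℝ} (hα : 1 < α) (hB : 0 < B) (hk : 0 < k)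
    (hθ : 0 < Real.cos θ) (hc : Real.cos (α * θ) ≤ -k) :
    ∫ x in Ioi (0 : ℝ), (∫ r in Ioi (0 : ℝ), sF α B θ x r).im
      = ∫ r in Ioi (0 : ℝ), (dF α B θ r).im / r := by
  have hi := sF_prod_int hα hB hk hθ hc
  have h1 : Integrable (fun x => ∫ r in Ioi (0 : ℝ), sF α B θ x r) (volume.restrict (Ioi 0)) :=
    hi.integral_prod_left
  have h2 : ∫ x in Ioi (0 : ℝ), (∫ r in Ioi (0 : ℝ), sF α B θ x r).im
    = (∫ x in Ioi (0 : ℝ), ∫ r in Ioi (0 : ℝ), sF α B θ x r).im := integral_im h1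
  rw [h2, integral_integral_swap hi,
    setIntegral_congr_fun measurableSet_Ioi (fun r hr => sF_inner hθ hr)]
  have hd : IntegrableOn (fun r : ℝ => dF α B θ r / r) (Ioi 0) := by
    refine Integrable.mono' (dF_div_int hα hB hk hθ hc)
      ((dF_measurable α B θ).div (by fun_prop)).aestronglyMeasurable ?_
    filter_upwards [ae_restrict_mem measurableSet_Ioi] with r hr
    rw [norm_div, Complex.norm_real, Real.norm_of_nonneg (le_of_lt hr)]
  have h3 : (∫ r in Ioi (0 : ℝ), dF α B θ r / r).im
    = ∫ r in Ioi (0 : ℝ), (dF α B θ r / r).im := (integral_im hd).symm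
  rw [h3]
  simp_rw [Complex.div_ofReal_im]

/-! ### The final evaluation -/

lemma dF_im_div_integral {α B θ : ℝ} (hα : 1 < α) (hB : 0 < B)
    (hθ0 : 0 < θ) (hθ1 : θ < π / 2) (hφ0 : π / 2 < α * θ) (hφ1 : α * θ < π) :
    ∫ r in Ioi (0 : ℝ), (dF α B θ r).im / r = π / α := by
  have hcos : 0 < Real.cos θ := Real.cos_pos_of_mem_Ioo ⟨by linarith, hθ1⟩
  have hsin : 0 < Real.sin θ := Real.sin_pos_of_pos_of_lt_pi hθ0 (by linarith)
  have hcos' : Real.cos (α * θ) < 0 :=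
    Real.cos_neg_of_pi_div_two_lt_of_lt hφ0 (by linarith)
  have hsin' : 0 < Real.sin (α * θ) := Real.sin_pos_of_pos_of_lt_pi (by linarith) hφ1
  have ha : 0 < -(B * Real.cos (α * θ)) := by nlinarith
  have hα0 : α ≠ 0 := by linarith
  set g : ℝ → ℝ := fun u => Real.exp (-(-(B * Real.cos (α * θ))) * u) *
    Real.sin (B * Real.sin (α * θ) * u) / u with hg
  have hgi : IntegrableOn g (Ioi 0) := aux_sin_div_int ha _
  have hgv : ∫ u in Ioi (0 : ℝ), g u = π - α * θ := by
    rw [hg, aux_sin_div_integral ha (by positivity)]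
    rw [show B * Real.sin (α * θ) / -(B * Real.cos (α * θ)) = Real.tan (π - α * θ) by
      rw [Real.tan_pi_sub, Real.tan_eq_sin_div_cos]; field_simp]
    exact Real.arctan_tan (by linarith) (by linarith)
  have hgi' := (integrableOn_Ioi_comp_rpow_iff g hα0).2 hgi
  have hgv' := integral_comp_rpow_Ioi g hα0
  rw [hgv] at hgv'
  have h2i := aux_sin_div_int hcos (Real.sin θ)
  have h2v : ∫ u in Ioi (0 : ℝ), Real.exp (-Real.cos θ * u) * Real.sin (Real.sin θ * u) / u = θ := by
    rw [aux_sin_div_integral hcos hsin.le, ← Real.tan_eq_sin_div_cos]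
    exact Real.arctan_tan (by linarith) hθ1
  have hsplit : ∀ r ∈ Ioi (0 : ℝ), (dF α B θ r).im / r
      = α⁻¹ * ((|α| * r ^ (α - 1)) • g (r ^ α)) +
        Real.exp (-Real.cos θ * r) * Real.sin (Real.sin θ * r) / r := by
    intro r hr
    have hr0 : 0 < r := hr
    have hra : 0 < r ^ α := by positivity
    rw [abs_of_pos (by linarith), Real.rpow_sub_one hr0.ne']
    simp only [hg, smul_eq_mul]
    unfold dF
    rw [Complex.sub_im, Complex.exp_im, Complex.exp_im, ← Complex.ofReal_neg]
    simp only [Complex.re_ofReal_mul, Complex.im_ofReal_mul, Complex.exp_ofReal_mul_I_re,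
      Complex.exp_ofReal_mul_I_im]
    rw [show -r * Real.sin θ = -(Real.sin θ * r) by ring, Real.sin_neg,
      show -r * Real.cos θ = -Real.cos θ * r by ring,
      show - -(B * Real.cos (α * θ)) * r ^ α = B * r ^ α * Real.cos (α * θ) by ring,
      show B * Real.sin (α * θ) * r ^ α = B * r ^ α * Real.sin (α * θ) by ring]
    field_simp
    ring
  rw [setIntegral_congr_fun measurableSet_Ioi hsplit, integral_add (hgi'.const_mul _) h2i,
    integral_const_mul, hgv', h2v]
  field_simp
  ring

/-- The totally negatively skewed stable density has mass `1/α` on the positive half line. -/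
theorem spectrally_negative_positive_mass (α b : ℝ) (hα1 : 1 < α) (hα2 : α ≤ 2) (hb : 0 < b) :
    ∀ t : ℝ, 0 < t →
      ∫ x in Set.Ioi (0 : ℝ), zolDensity α (2 - α) (b ^ (-α) * t) x = 1 / α := by
  intro t ht
  have hα0 : 0 < α := by linarith
  set B := b ^ (-α) * t with hBdef
  have hB : 0 < B := by positivity
  have hπ := Real.pi_pos
  obtain ⟨θ₁, h1a, h1b⟩ : ∃ θ₁, π / (2 * α) < θ₁ ∧ θ₁ < π / 2 :=
    exists_between (by gcongr; linarith)
  obtain ⟨θ₀, h0a, h0b⟩ : ∃ θ₀, θ₁ < θ₀ ∧ θ₀ < π / 2 := exists_between h1b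
  have hφ1 : π / 2 < α * θ₁ := by
    rw [div_lt_iff₀ (by positivity)] at h1a
    linarith
  have hθ1pos : 0 < θ₁ := lt_trans (by positivity) h1a
  have hφ1' : α * θ₁ < π := by nlinarith
  have hφ0' : α * θ₀ < π := by nlinarith
  have hφ0 : π / 2 < α * θ₀ := by nlinarith
  set k := -Real.cos (α * θ₁) with hkdef
  have hk : 0 < k := by
    have := Real.cos_neg_of_pi_div_two_lt_of_lt hφ1 (by linarith)
    linarith
  have hall : ∀ θ ∈ Icc θ₁ (π / 2), 0 ≤ Real.cos θ ∧ Real.cos (α * θ) ≤ -k := by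
    intro θ hθ
    refine ⟨Real.cos_nonneg_of_mem_Icc ⟨by linarith [hθ.1], hθ.2⟩, ?_⟩
    rw [hkdef, neg_neg]
    apply Real.cos_le_cos_of_nonneg_of_le_pi (by positivity)
    · nlinarith [hθ.2, hθ.1]
    · exact mul_le_mul_of_nonneg_left hθ.1 hα0.le
  have hcos0 : 0 < Real.cos θ₀ := Real.cos_pos_of_mem_Ioo ⟨by linarith, h0b⟩
  have hc0 := (hall θ₀ ⟨h0a.le, h0b.le⟩).2
  have key : ∀ x ∈ Ioi (0 : ℝ), zolDensity α (2 - α) B x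
      = (1 / π) * (∫ r in Ioi (0 : ℝ), sF α B θ₀ x r).im := by
    intro x hx
    have hx0 : 0 ≤ x := le_of_lt hx
    rw [zol_eq_ray hα0 hB hx0 hk (hall _ ⟨h1b.le, le_rfl⟩).2,
      ray_rotate hα0 hB hx0 hk h0a h0b hall, ray_sub hα0 hB hx0 hk hcos0 hc0]
  rw [setIntegral_congr_fun measurableSet_Ioi key, integral_const_mul,
    sF_fubini hα1 hB hk hcos0 hc0, dF_im_div_integral hα1 hB (by linarith) h0b hφ0 hφ0']
  field_simp
end

section
/- Series representation of the stable subordinator density: For 1/2 ≤ γ < 1 and every x > 0, the inverse Fourier integral (1/(2π)) ∫_{−∞}^{∞} e^{−iλx} exp(−|λ|^γ e^{−iπγ·sgn(λ)/2}) dλ equals the convergent series (1/π) Σ_{k=1}^∞ (−1)^{k+1} (Γ(γk+1)/k!) x^{−γk−1} sin(πkγ). -/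
open MeasureTheory Real

open Set Filter Topology in
lemma sds_shift (F : ℂ → ℂ) (hF : Differentiable ℂ F) (a : ℝ) (ha : a ≤ 0) (M N : ℝ → ℝ)
    (hM : ∀ᶠ u in atTop, ∀ y ∈ Icc a 0, ‖F (((u:ℝ):ℂ) + (y:ℝ) * Complex.I)‖ ≤ M u)
    (hN : ∀ᶠ u in atBot, ∀ y ∈ Icc a 0, ‖F (((u:ℝ):ℂ) + (y:ℝ) * Complex.I)‖ ≤ N u)
    (hM0 : Tendsto M atTop (𝓝 0)) (hN0 : Tendsto N atBot (𝓝 0))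
    (h1 : Integrable (fun u : ℝ => F (u + (a:ℝ) * Complex.I)))
    (h2 : Integrable (fun u : ℝ => F u)) :
    ∫ u : ℝ, F u = ∫ u : ℝ, F (u + (a:ℝ) * Complex.I) := by
  have L1 := intervalIntegral_tendsto_integral h1 tendsto_neg_atTop_atBot tendsto_id
  have L2 := intervalIntegral_tendsto_integral h2 tendsto_neg_atTop_atBot tendsto_id
  have key : ∀ (P : ℝ → ℝ) (l : Filter ℝ), (∀ᶠ u in l, ∀ y ∈ Icc a 0, ‖F (((u:ℝ):ℂ) + (y:ℝ) * Complex.I)‖ ≤ P u) →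
      Tendsto P l (𝓝 0) → Tendsto (fun u : ℝ => ∫ y in a..0, F (((u:ℝ):ℂ) + (y:ℝ) * Complex.I)) l (𝓝 0) := by
    intro P l hP hP0
    refine squeeze_zero_norm' (a := fun u => P u * |0 - a|) ?_ (by simpa using hP0.mul_const _)
    filter_upwards [hP] with u hu
    refine intervalIntegral.norm_integral_le_of_norm_le_const ?_
    intro y hy
    rw [uIoc_of_le ha] at hy
    exact hu y ⟨hy.1.le, hy.2⟩
  have V1 := key M atTop hM hM0
  have V2 := (key N atBot hN hN0).comp tendsto_neg_atTop_atBot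
  have C : ∀ T : ℝ, (∫ u in (-T)..T, F (u + (a:ℝ) * Complex.I)) - (∫ u in (-T)..T, F u)
      + Complex.I • (∫ y in a..0, F ((T:ℂ) + (y:ℝ) * Complex.I)) - Complex.I • (∫ y in a..0, F (((-T:ℝ):ℂ) + (y:ℝ) * Complex.I)) = 0 := by
    intro T
    have := Complex.integral_boundary_rect_eq_zero_of_differentiableOn F (-T + a * Complex.I) T hF.differentiableOn
    simpa using this
  have L := ((L1.sub L2).add (V1.const_smul Complex.I)).sub (V2.const_smul Complex.I)
  have L' := L.congr (f₂ := fun _ => (0:ℂ)) (fun T => by simpa using C T)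
  have := tendsto_nhds_unique L' tendsto_const_nhds
  simp only [smul_zero, add_zero, sub_zero] at this
  exact (sub_eq_zero.1 this).symm

open Set in
lemma sds_exp_cov (f : ℝ → ℂ) :
    (IntegrableOn f (Ioi 0) ↔ Integrable (fun u : ℝ => (Real.exp u : ℂ) * f (Real.exp u))) ∧
    ∫ r in Ioi 0, f r = ∫ u : ℝ, (Real.exp u : ℂ) * f (Real.exp u) := by
  have hi : Real.exp '' univ = Ioi 0 := by rw [image_univ, Real.range_exp]
  have hd : ∀ u ∈ (univ : Set ℝ), HasDerivWithinAt Real.exp (Real.exp u) univ u :=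
    fun u _ => (Real.hasDerivAt_exp u).hasDerivWithinAt
  have h1 := integrableOn_image_iff_integrableOn_abs_deriv_smul MeasurableSet.univ hd
    Real.exp_injective.injOn f
  have h2 := integral_image_eq_integral_abs_deriv_smul MeasurableSet.univ hd
    Real.exp_injective.injOn f
  rw [hi] at h1 h2
  simp only [Real.abs_exp, Complex.real_smul, integrableOn_univ, Measure.restrict_univ] at h1 h2
  exact ⟨h1, h2⟩

open Filter in
lemma sds_rpow_le (γ : ℝ) (hγ2 : γ < 1) (a : ℝ) (ha : 0 < a) :
    ∀ᶠ s : ℝ in atTop, s ^ γ ≤ a * s := by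
  have := (tendsto_rpow_atTop (show 0 < 1 - γ by linarith)).eventually_ge_atTop (1 / a)
  filter_upwards [this, eventually_gt_atTop 0] with s hs h0
  have h3 : s = s ^ γ * s ^ (1 - γ) := by
    rw [← Real.rpow_add h0]; simp
  have h4 : 0 < s ^ γ := Real.rpow_pos_of_pos h0 _
  calc s ^ γ = a * (s ^ γ * (1 / a)) := by field_simp
    _ ≤ a * (s ^ γ * s ^ (1 - γ)) := by gcongr
    _ = a * s := by rw [← h3]

open Set Filter in
lemma sds_int (γ : ℝ) (hγ0 : 0 < γ) (hγ2 : γ < 1) (x : ℝ) (hx : 0 < x) :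
    IntegrableOn (fun s : ℝ => Real.exp (-(x * s)) * Real.exp (s ^ γ)) (Ioi 0) := by
  refine integrable_of_isBigO_exp_neg (b := x / 2) (by positivity) ?_ ?_
  · refine Continuous.continuousOn ?_
    have := Real.continuous_rpow_const hγ0.le
    fun_prop
  · refine Asymptotics.IsBigO.of_bound 1 ?_
    filter_upwards [sds_rpow_le γ hγ2 (x / 2) (by positivity)] with s hs
    rw [← Real.exp_add, one_mul, Real.norm_of_nonneg (Real.exp_pos _).le, Real.norm_of_nonneg (Real.exp_pos _).le]
    apply Real.exp_le_exp.2
    linarith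

open Set Filter in
lemma sds_series (γ : ℝ) (hγ0 : 0 < γ) (hγ2 : γ < 1) (x : ℝ) (hx : 0 < x) (w : ℂ) (hw : ‖w‖ = 1) :
    HasSum (fun k : ℕ => ((Real.Gamma (γ * k + 1) / (Nat.factorial k) * x ^ (-γ * k - 1) : ℝ) : ℂ) * (-w) ^ k)
      (∫ s in Ioi 0, ((Real.exp (-(x * s)) : ℝ) : ℂ) * Complex.exp (-((s ^ γ : ℝ) : ℂ) * w)) := by
  set G : ℕ → ℝ → ℝ := fun k s => Real.exp (-(x * s)) * ((s ^ γ) ^ k / (Nat.factorial k)) with hG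
  have hGi : ∀ k, IntegrableOn (G k) (Ioi 0) := by
    intro k
    refine (sds_int γ hγ0 hγ2 x hx).mono' ?_ ?_
    · refine Continuous.aestronglyMeasurable ?_
      have := Real.continuous_rpow_const hγ0.le
      fun_prop
    · filter_upwards [ae_restrict_mem measurableSet_Ioi] with s hs
      have h0 : 0 ≤ s ^ γ := Real.rpow_nonneg (le_of_lt hs) _
      rw [Real.norm_of_nonneg (by positivity)]
      exact mul_le_mul_of_nonneg_left (Real.pow_div_factorial_le_exp _ h0 k) (Real.exp_pos _).le
  have hGv : ∀ k, ∫ s in Ioi 0, G k s = Real.Gamma (γ * k + 1) / (Nat.factorial k) * x ^ (-γ * k - 1) := by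
    intro k
    have h := Real.integral_rpow_mul_exp_neg_mul_Ioi (a := γ * k + 1) (r := x) (by positivity) hx
    have h' : ∫ s in Ioi 0, G k s = ∫ s in Ioi 0, (s ^ (γ * k + 1 - 1) * Real.exp (-(x * s))) * (1 / (Nat.factorial k : ℝ)) := by
      refine setIntegral_congr_fun measurableSet_Ioi fun s hs => ?_
      simp only [hG]
      rw [← Real.rpow_natCast, ← Real.rpow_mul (le_of_lt hs), add_sub_cancel_right]
      ring
    rw [h', integral_mul_const, h, one_div, Real.inv_rpow hx.le, ← Real.rpow_neg hx.le]
    rw [show -(γ * k + 1) = -γ * k - 1 by ring]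
    ring
  have hGn : ∀ k, 0 ≤ ∫ s in Ioi 0, G k s := by
    intro k
    refine setIntegral_nonneg measurableSet_Ioi fun s hs => ?_
    have h0 : 0 ≤ s ^ γ := Real.rpow_nonneg (le_of_lt hs) _
    simp only [hG]; positivity
  have hGs : Summable (fun k => ∫ s in Ioi 0, G k s) := by
    refine summable_of_sum_range_le (c := ∫ s in Ioi 0, Real.exp (-(x * s)) * Real.exp (s ^ γ)) hGn ?_
    intro n
    rw [← integral_finsetSum _ (fun k _ => hGi k)]
    refine setIntegral_mono_on (integrable_finsetSum _ fun k _ => hGi k) (sds_int γ hγ0 hγ2 x hx) measurableSet_Ioi ?_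
    intro s hs
    have h0 : 0 ≤ s ^ γ := Real.rpow_nonneg (le_of_lt hs) _
    simp only [hG]
    rw [← Finset.mul_sum]
    exact mul_le_mul_of_nonneg_left (Real.sum_le_exp_of_nonneg h0 n) (Real.exp_pos _).le
  have hn : ∀ k, ∀ s ∈ Ioi (0:ℝ), ‖((G k s : ℝ) : ℂ) * (-w) ^ k‖ = G k s := by
    intro k s hs
    have h0 : 0 ≤ s ^ γ := Real.rpow_nonneg (le_of_lt hs) _
    have : 0 ≤ G k s := by simp only [hG]; positivity
    simp [hw, abs_of_nonneg this]
  have main := hasSum_integral_of_summable_integral_norm (μ := volume.restrict (Ioi (0:ℝ)))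
    (F := fun k s => ((G k s : ℝ) : ℂ) * (-w) ^ k)
    (fun k => (hGi k).ofReal.mul_const _) (by
      refine hGs.congr fun k => ?_
      exact (setIntegral_congr_fun measurableSet_Ioi (hn k)).symm)
  have hs : ∀ s : ℝ, ∑' k, ((G k s : ℝ) : ℂ) * (-w) ^ k = ((Real.exp (-(x * s)) : ℝ) : ℂ) * Complex.exp (-((s ^ γ : ℝ) : ℂ) * w) := by
    intro s
    have h := (NormedSpace.expSeries_div_hasSum_exp (-((s ^ γ : ℝ) : ℂ) * w)).mul_left (((Real.exp (-(x * s)) : ℝ) : ℂ))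
    rw [← Complex.exp_eq_exp_ℂ] at h
    rw [← h.tsum_eq]
    congr 1; ext k
    simp only [hG]; push_cast
    rw [show -((s ^ γ : ℝ) : ℂ) * w = ((s ^ γ : ℝ) : ℂ) * (-w) by ring, mul_pow]; ring
  simp only [hs] at main
  refine main.congr_fun ?_ |> id
  intro k
  rw [integral_mul_const, integral_complex_ofReal, hGv]

open Set in
lemma sds_int_half (γ : ℝ) (hγ0 : 0 < γ) (hγ2 : γ < 1) (x : ℝ) :
    IntegrableOn (fun r : ℝ => Complex.exp (-Complex.I * r * x) *
      Complex.exp (-((r ^ γ : ℝ) : ℂ) * Complex.exp (-Complex.I * Real.pi * γ / 2))) (Ioi 0) := by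
  have hc : 0 < Real.cos (Real.pi * γ / 2) := by
    apply Real.cos_pos_of_mem_Ioo
    constructor <;> nlinarith [Real.pi_pos]
  have h := integrableOn_rpow_mul_exp_neg_mul_rpow (s := 0) (by norm_num) hγ0 hc
  refine h.mono' ?_ ?_
  · refine Continuous.aestronglyMeasurable ?_
    have := Real.continuous_rpow_const hγ0.le
    fun_prop
  · filter_upwards with r
    rw [norm_mul, Complex.norm_exp, Complex.norm_exp, Real.rpow_zero, one_mul, ← Real.exp_add]
    rw [show -Complex.I * Real.pi * γ / 2 = ((-(Real.pi * γ / 2) : ℝ) : ℂ) * Complex.I by push_cast; ring]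
    rw [Complex.exp_mul_I, ← Complex.ofReal_cos, ← Complex.ofReal_sin]
    apply le_of_eq
    congr 1
    simp only [Complex.add_re, Complex.mul_re, Complex.mul_im, Complex.neg_re, Complex.neg_im, Complex.ofReal_re, Complex.ofReal_im, Complex.I_re, Complex.I_im, Complex.add_im, Real.cos_neg, Real.sin_neg]
    ring

open Set Filter Topology in
lemma sds_rotate (γ : ℝ) (hγ0 : 0 < γ) (hγ2 : γ < 1) (x : ℝ) (hx : 0 < x) :
    ∫ r in Ioi (0:ℝ), Complex.exp (-Complex.I * r * x) *
      Complex.exp (-((r ^ γ : ℝ) : ℂ) * Complex.exp (-Complex.I * Real.pi * γ / 2)) =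
    -Complex.I * ∫ s in Ioi (0:ℝ), ((Real.exp (-(x * s)) : ℝ) : ℂ) *
      Complex.exp (-((s ^ γ : ℝ) : ℂ) * Complex.exp (-Complex.I * Real.pi * γ)) := by
  have hpi := Real.pi_pos
  set F : ℂ → ℂ := fun w => Complex.exp (w - Complex.I * x * Complex.exp w
    - Complex.exp (γ * (w - Complex.I * Real.pi / 2))) with hF
  have hFd : Differentiable ℂ F := by
    simp only [hF]; fun_prop
  have hpow : ∀ u : ℝ, ((Real.exp u) ^ γ : ℝ) = Real.exp (γ * u) := by
    intro u; rw [← Real.exp_mul, mul_comm]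
  have e1 : ∀ u : ℝ, (Real.exp u : ℂ) * (Complex.exp (-Complex.I * (Real.exp u : ℝ) * x) *
      Complex.exp (-(((Real.exp u) ^ γ : ℝ) : ℂ) * Complex.exp (-Complex.I * Real.pi * γ / 2))) = F u := by
    intro u
    simp only [hF, hpow]
    push_cast
    rw [← Complex.exp_add, ← Complex.exp_add, neg_mul (Complex.exp _), ← Complex.exp_add]
    congr 1
    rw [show (γ:ℂ) * (u - Complex.I * Real.pi / 2) = γ * u + -Complex.I * Real.pi * γ / 2 by ring]
    ring
  have e2 : ∀ u : ℝ, (Real.exp u : ℂ) * (-Complex.I * (((Real.exp (-(x * Real.exp u)) : ℝ) : ℂ) *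
      Complex.exp (-(((Real.exp u) ^ γ : ℝ) : ℂ) * Complex.exp (-Complex.I * Real.pi * γ))))
      = F (u + (-(Real.pi / 2) : ℝ) * Complex.I) := by
    intro u
    have hI : Complex.exp (-(Real.pi / 2) * Complex.I) = -Complex.I := by
      have := Complex.exp_neg_pi_div_two_mul_I
      simpa [neg_div] using this
    simp only [hF, hpow]
    push_cast
    rw [Complex.exp_add (u:ℂ), hI]
    rw [show (γ:ℂ) * (u + -(Real.pi / 2) * Complex.I - Complex.I * Real.pi / 2) = γ * u + -Complex.I * Real.pi * γ by ring]
    rw [Complex.exp_add ((γ:ℂ) * u)]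
    rw [show (u:ℂ) + -(Real.pi / 2) * Complex.I - Complex.I * x * (Complex.exp u * -Complex.I) -
      Complex.exp (γ * u) * Complex.exp (-Complex.I * Real.pi * γ) = u + (-(Real.pi / 2) * Complex.I + 
        (-(x * Complex.exp u) + -Complex.exp (γ * u) * Complex.exp (-Complex.I * Real.pi * γ))) by
      ring_nf; simp only [Complex.I_sq]; ring]
    rw [Complex.exp_add, Complex.exp_add, Complex.exp_add, hI]
  have nrm : ∀ u y : ℝ, ‖F (u + y * Complex.I)‖ = Real.exp (u + x * Real.exp u * Real.sin y
      - Real.exp (γ * u) * Real.cos (γ * (y - Real.pi / 2))) := by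
    intro u y
    simp only [hF]
    rw [Complex.norm_exp]
    congr 1
    rw [show (γ:ℂ) * (u + y * Complex.I - Complex.I * Real.pi / 2) = ((γ * u : ℝ) : ℂ) + ((γ * (y - Real.pi / 2) : ℝ) : ℂ) * Complex.I by push_cast; ring]
    rw [Complex.exp_add, Complex.exp_add, Complex.exp_mul_I, Complex.exp_mul_I]
    simp only [← Complex.ofReal_cos, ← Complex.ofReal_sin, ← Complex.ofReal_exp]
    simp only [Complex.sub_re, Complex.add_re, Complex.mul_re, Complex.mul_im, Complex.neg_re, Complex.neg_im, Complex.ofReal_re, Complex.ofReal_im, Complex.I_re, Complex.I_im, Complex.add_im]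
    ring
  have hc : 0 < Real.cos (γ * Real.pi / 2) := by
    apply Real.cos_pos_of_mem_Ioo
    constructor <;> nlinarith [Real.pi_pos]
  set c := Real.cos (γ * Real.pi / 2) with hcdef
  have B1 : ∀ᶠ u : ℝ in atTop, ∀ y ∈ Icc (-(Real.pi / 2)) 0, ‖F (((u:ℝ):ℂ) + (y:ℝ) * Complex.I)‖ ≤ Real.exp (-u) := by
    have h1 := Real.tendsto_exp_atTop.eventually (sds_rpow_le γ hγ2 (x * (2 / Real.pi)) (by positivity))
    filter_upwards [h1, eventually_ge_atTop 0, eventually_ge_atTop (4 / (c * γ ^ 2))] with u hu hu0 hu1 y hy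
    rw [nrm, Real.exp_le_exp]
    rw [hpow] at hu
    have hs := Real.mul_le_sin (x := -y) (by linarith [hy.2]) (by linarith [hy.1])
    rw [Real.sin_neg] at hs
    have hcos := Real.abs_cos_sub_cos_le (γ * (y - Real.pi / 2)) (-(γ * Real.pi / 2))
    rw [Real.cos_neg, ← hcdef, show γ * (y - Real.pi / 2) - -(γ * Real.pi / 2) = γ * y by ring,
      abs_mul, abs_of_pos hγ0, abs_of_nonpos hy.2] at hcos
    have hcos' : c - (-y) ≤ Real.cos (γ * (y - Real.pi / 2)) := by
      have := (abs_le.1 hcos).1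
      nlinarith [hy.2]
    have hE := Real.exp_pos u
    have hEg := Real.exp_pos (γ * u)
    have t1 : x * Real.exp u * Real.sin y ≤ - (x * Real.exp u * (2 / Real.pi * -y)) := by
      have := mul_le_mul_of_nonneg_left hs (mul_pos hx hE).le
      linarith
    have t2 := mul_le_mul_of_nonneg_left hcos' hEg.le
    have t3 := mul_le_mul_of_nonneg_right hu (show 0 ≤ -y by linarith [hy.2])
    have q := Real.quadratic_le_exp_of_nonneg (x := γ * u) (by positivity)
    have t4 : 2 * u ≤ c * Real.exp (γ * u) := by
      have h4 : 4 ≤ u * (c * γ ^ 2) := by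
        rwa [div_le_iff₀ (by positivity)] at hu1
      have h5 : (γ * u) ^ 2 / 2 ≤ Real.exp (γ * u) := by
        have : 0 ≤ γ * u := by positivity
        linarith
      have h6 := mul_le_mul_of_nonneg_left h5 hc.le
      nlinarith
    nlinarith
  have B2 : ∀ᶠ u : ℝ in atBot, ∀ y ∈ Icc (-(Real.pi / 2)) 0, ‖F (((u:ℝ):ℂ) + (y:ℝ) * Complex.I)‖ ≤ Real.exp (u + 1) := by
    filter_upwards [eventually_le_atBot 0] with u hu y hy
    rw [nrm, Real.exp_le_exp]
    have hs : Real.sin y ≤ 0 := Real.sin_nonpos_of_nonpos_of_neg_pi_le hy.2 (by linarith [hy.1])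
    have hE := Real.exp_pos u
    have t1 : x * Real.exp u * Real.sin y ≤ 0 := mul_nonpos_of_nonneg_of_nonpos (by positivity) hs
    have t2 : Real.exp (γ * u) ≤ 1 := Real.exp_le_one_iff.2 (mul_nonpos_of_nonneg_of_nonpos hγ0.le hu)
    have t3 := Real.neg_one_le_cos (γ * (y - Real.pi / 2))
    nlinarith [Real.exp_pos (γ * u)]
  have i0 := sds_exp_cov (fun r : ℝ => Complex.exp (-Complex.I * r * x) *
      Complex.exp (-((r ^ γ : ℝ) : ℂ) * Complex.exp (-Complex.I * Real.pi * γ / 2)))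
  have i1 := sds_exp_cov (fun s : ℝ => -Complex.I * (((Real.exp (-(x * s)) : ℝ) : ℂ) *
      Complex.exp (-((s ^ γ : ℝ) : ℂ) * Complex.exp (-Complex.I * Real.pi * γ))))
  have I1 : IntegrableOn (fun s : ℝ => -Complex.I * (((Real.exp (-(x * s)) : ℝ) : ℂ) *
      Complex.exp (-((s ^ γ : ℝ) : ℂ) * Complex.exp (-Complex.I * Real.pi * γ)))) (Ioi 0) := by
    refine (sds_int γ hγ0 hγ2 x hx).mono' ?_ ?_
    · refine Continuous.aestronglyMeasurable ?_
      have := Real.continuous_rpow_const hγ0.le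
      fun_prop
    · filter_upwards [ae_restrict_mem measurableSet_Ioi] with s hs
      have h0 : 0 ≤ s ^ γ := Real.rpow_nonneg (le_of_lt hs) _
      rw [norm_mul, norm_mul, norm_neg, Complex.norm_I, one_mul, Complex.norm_real,
        Real.norm_of_nonneg (Real.exp_pos _).le]
      refine mul_le_mul_of_nonneg_left ?_ (Real.exp_pos _).le
      refine (Complex.norm_exp_le_exp_norm _).trans ?_
      rw [Real.exp_le_exp, norm_mul, norm_neg, Complex.norm_real, Real.norm_of_nonneg h0,
        Complex.norm_exp]
      simp
  simp only [e1] at i0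
  simp only [e2] at i1
  rw [← integral_const_mul, i0.2, i1.2]
  refine sds_shift F hFd _ (by linarith) _ _ B1 B2 ?_ ?_ (i1.1.1 I1) (i0.1.1 (sds_int_half γ hγ0 hγ2 x))
  · exact Real.tendsto_exp_atBot.comp tendsto_neg_atTop_atBot
  · exact Real.tendsto_exp_atBot.comp (tendsto_atBot_add_const_right _ _ tendsto_id)

open Set in
lemma sds_full (γ : ℝ) (hγ0 : 0 < γ) (hγ2 : γ < 1) (x : ℝ) :
    (∫ l : ℝ, Complex.exp (-Complex.I * (l : ℂ) * (x : ℂ)) *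
          Complex.exp (-((|l| ^ γ : ℝ) : ℂ) *
            Complex.exp (-Complex.I * (Real.pi : ℂ) * (γ : ℂ) *
              ((Real.sign l : ℝ) : ℂ) / 2))).re =
    2 * (∫ r in Ioi (0:ℝ), Complex.exp (-Complex.I * r * x) *
      Complex.exp (-((r ^ γ : ℝ) : ℂ) * Complex.exp (-Complex.I * Real.pi * γ / 2))).re := by
  set f : ℝ → ℂ := fun l => Complex.exp (-Complex.I * (l : ℂ) * (x : ℂ)) *
          Complex.exp (-((|l| ^ γ : ℝ) : ℂ) *
            Complex.exp (-Complex.I * (Real.pi : ℂ) * (γ : ℂ) *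
              ((Real.sign l : ℝ) : ℂ) / 2)) with hf
  set g : ℝ → ℂ := fun r => Complex.exp (-Complex.I * r * x) *
      Complex.exp (-((r ^ γ : ℝ) : ℂ) * Complex.exp (-Complex.I * Real.pi * γ / 2)) with hg
  have hgi : IntegrableOn g (Ioi 0) := sds_int_half γ hγ0 hγ2 x
  have efg : EqOn g f (Ioi 0) := by
    intro r hr
    simp only [hf, hg]
    rw [abs_of_pos hr, Real.sign_of_pos hr]; simp
  have efn : EqOn (fun r => (starRingEnd ℂ) (g r)) (fun r => f (-r)) (Ioi 0) := by
    intro r hr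
    simp only [hf, hg]
    rw [abs_neg, abs_of_pos hr, Real.sign_neg, Real.sign_of_pos hr]
    simp only [map_mul, ← Complex.exp_conj, map_neg, Complex.conj_I, Complex.conj_ofReal, map_div₀, map_ofNat]
    push_cast
    congr 2
    · ring
    · congr 2; ring
  have fi : IntegrableOn f (Ioi 0) := hgi.congr_fun efg measurableSet_Ioi
  have fni : IntegrableOn (fun r => f (-r)) (Ioi 0) := by
    refine IntegrableOn.congr_fun ?_ efn measurableSet_Ioi
    exact (LinearIsometryEquiv.integrable_comp_iff (Complex.conjLIE)).2 hgi
  have fi2 : IntegrableOn f (Iic 0) := by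
    have := (integrableOn_Ici_iff_integrableOn_Ioi (by finiteness)).2 fni
    have := IntegrableOn.comp_neg_Iic (f := fun r => f (-r)) (c := 0) (by simpa using this)
    simpa using this
  rw [← intervalIntegral.integral_Iic_add_Ioi fi2 fi]
  have h1 : ∫ l in Iic 0, f l = (starRingEnd ℂ) (∫ r in Ioi 0, g r) := by
    rw [← integral_conj, setIntegral_congr_fun measurableSet_Ioi efn, integral_comp_neg_Ioi, neg_zero]
  rw [h1, ← setIntegral_congr_fun measurableSet_Ioi efg, Complex.add_re, Complex.conj_re]
  ring

/-- Series representation of the stable subordinator density: the inverse Fourier integral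
equals the convergent series, for `1/2 ≤ γ < 1` and `x > 0`. -/
theorem subordinator_density_series (γ : ℝ) (hγ1 : 1 / 2 ≤ γ) (hγ2 : γ < 1)
    (x : ℝ) (hx : 0 < x) :
    Summable (fun n : ℕ => (-1 : ℝ) ^ (n + 1 + 1) *
        (Real.Gamma (γ * ((n : ℝ) + 1) + 1) / (Nat.factorial (n + 1))) *
        x ^ (-γ * ((n : ℝ) + 1) - 1) * Real.sin (Real.pi * ((n : ℝ) + 1) * γ)) ∧
    (1 / (2 * Real.pi)) *
      (∫ l : ℝ, Complex.exp (-Complex.I * (l : ℂ) * (x : ℂ)) *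
          Complex.exp (-((|l| ^ γ : ℝ) : ℂ) *
            Complex.exp (-Complex.I * (Real.pi : ℂ) * (γ : ℂ) *
              ((Real.sign l : ℝ) : ℂ) / 2))).re =
      (1 / Real.pi) * ∑' n : ℕ, (-1 : ℝ) ^ (n + 1 + 1) *
        (Real.Gamma (γ * ((n : ℝ) + 1) + 1) / (Nat.factorial (n + 1))) *
        x ^ (-γ * ((n : ℝ) + 1) - 1) * Real.sin (Real.pi * ((n : ℝ) + 1) * γ) := by
  have hγ0 : 0 < γ := by linarith
  set w : ℂ := Complex.exp (-Complex.I * Real.pi * γ) with hw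
  have hw1 : ‖w‖ = 1 := by rw [hw, Complex.norm_exp]; simp
  have S := sds_series γ hγ0 hγ2 x hx w hw1
  have S2 := Complex.hasSum_im S
  have S3 := (hasSum_nat_add_iff' 1).2 S2
  have term : ∀ n : ℕ, (((Real.Gamma (γ * ((n + 1 : ℕ) : ℝ) + 1) / (Nat.factorial (n + 1)) *
      x ^ (-γ * ((n + 1 : ℕ) : ℝ) - 1) : ℝ) : ℂ) * (-w) ^ (n + 1)).im =
      (-1 : ℝ) ^ (n + 1 + 1) *
        (Real.Gamma (γ * ((n : ℝ) + 1) + 1) / (Nat.factorial (n + 1))) *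
        x ^ (-γ * ((n : ℝ) + 1) - 1) * Real.sin (Real.pi * ((n : ℝ) + 1) * γ) := by
    intro n
    have h1 : (-w) ^ (n + 1) = (((-1 : ℝ) ^ (n + 1) : ℝ) : ℂ) *
        Complex.exp (((-(Real.pi * ((n : ℝ) + 1) * γ) : ℝ) : ℂ) * Complex.I) := by
      rw [neg_pow, hw, ← Complex.exp_nat_mul]
      push_cast
      congr 2
      ring
    rw [h1, Complex.im_ofReal_mul, Complex.im_ofReal_mul, Complex.exp_ofReal_mul_I_im, Real.sin_neg]; push_cast; ring
  have S4 := S3.congr_fun (fun n => (term n).symm)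
  refine ⟨S4.summable, ?_⟩
  rw [S4.tsum_eq, sds_full γ hγ0 hγ2 x, sds_rotate γ hγ0 hγ2 x hx, ← hw]
  simp only [Finset.range_one, Finset.sum_singleton, pow_zero, mul_one, Complex.ofReal_im, sub_zero, Complex.mul_re, Complex.neg_re, Complex.neg_im, Complex.I_re, Complex.I_im]
  field_simp
  ring
end

section
/- Caputo-in-time equation for a spectrally negative stable density: Let 1 < α ≤ 2, γ = 1/α, b > 0, and let P(x,t) = p_α(x; 2−α, b^{−α} t). Then for all t > 0 and x > 0, b · (1/Γ(1−γ)) ∫_0^t (∂P/∂r)(x,r) (t−r)^{−γ} dr = −(∂P/∂x)(x,t). -/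
open MeasureTheory Real Set

open Filter Topology

lemma ct_integrable_exp {s m : ℝ} (hs : 0 < s) (hm : 0 < m) :
    Integrable (fun u : ℝ => Real.exp (s * u) * Real.exp (-m * Real.exp u)) := by
  have h := integrableOn_rpow_mul_exp_neg_mul_rpow (p := 1) (s := s - 1) (b := m)
    (by linarith) one_pos hm
  have himg : Real.exp '' univ = Ioi 0 := by rw [image_univ, Real.range_exp]
  rw [← himg, integrableOn_image_iff_integrableOn_abs_deriv_smul MeasurableSet.univ
    (fun x _ => (Real.hasDerivAt_exp x).hasDerivWithinAt) Real.exp_injective.injOn,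
    integrableOn_univ] at h
  refine h.congr (Eventually.of_forall fun u => ?_)
  simp only [Real.rpow_one, smul_eq_mul, Real.abs_exp]
  rw [← Real.exp_mul, ← mul_assoc, ← Real.exp_add]
  congr 2; ring

lemma ct_integral_Ioi {E : Type*} [NormedAddCommGroup E] [NormedSpace ℝ E] (g : ℝ → E) :
    ∫ x in Ioi (0 : ℝ), g x = ∫ u : ℝ, Real.exp u • g (Real.exp u) := by
  have himg : Real.exp '' univ = Ioi 0 := by rw [image_univ, Real.range_exp]
  rw [← himg, integral_image_eq_integral_abs_deriv_smul MeasurableSet.univ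
    (fun x _ => (Real.hasDerivAt_exp x).hasDerivWithinAt) Real.exp_injective.injOn]
  simp [Real.abs_exp]

lemma ct_tendsto_top {s m : ℝ} (hm : 0 < m) :
    Tendsto (fun u : ℝ => Real.exp (s * u) * Real.exp (-m * Real.exp u)) atTop (𝓝 0) := by
  have h := (tendsto_rpow_mul_exp_neg_mul_atTop_nhds_zero s m hm).comp Real.tendsto_exp_atTop
  refine h.congr fun u => ?_
  simp only [Function.comp]
  rw [← Real.exp_mul, mul_comm u s]

lemma ct_tendsto_bot {s m : ℝ} (hs : 0 < s) (hm : 0 < m) :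
    Tendsto (fun u : ℝ => Real.exp (s * u) * Real.exp (-m * Real.exp u)) atBot (𝓝 0) := by
  have h : Tendsto (fun u : ℝ => Real.exp (s * u)) atBot (𝓝 0) :=
    Real.tendsto_exp_atBot.comp (tendsto_id.const_mul_atBot hs)
  refine squeeze_zero (fun u => by positivity) (fun u => ?_) h
  refine mul_le_of_le_one_right (by positivity) ?_
  rw [Real.exp_le_one_iff]
  have := Real.exp_pos u
  nlinarith

lemma ct_rotate {G : ℂ → ℂ} (hG : Differentiable ℂ G) {p q s m C : ℝ} (hpq : p ≤ q)
    (hs : 0 < s) (hm : 0 < m)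
    (hbd : ∀ u v : ℝ, p ≤ v → v ≤ q →
      ‖G (u + v * Complex.I)‖ ≤ C * (Real.exp (s * u) * Real.exp (-m * Real.exp u))) :
    ∫ u : ℝ, G (u + p * Complex.I) = ∫ u : ℝ, G (u + q * Complex.I) := by
  have hInt : ∀ v : ℝ, p ≤ v → v ≤ q → Integrable (fun u : ℝ => G (u + v * Complex.I)) := by
    intro v h1 h2
    refine ((ct_integrable_exp hs hm).const_mul C).mono' ?_ (Eventually.of_forall fun u => hbd u v h1 h2)
    exact (hG.continuous.comp (by fun_prop)).aestronglyMeasurable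
  have hvert : ∀ l : Filter ℝ, Tendsto (fun u : ℝ => Real.exp (s * u) * Real.exp (-m * Real.exp u)) l (𝓝 0) →
      Tendsto (fun T : ℝ => ∫ y in p..q, G (T + y * Complex.I)) l (𝓝 0) := by
    intro l hl
    have h2 : Tendsto (fun u : ℝ => C * (Real.exp (s * u) * Real.exp (-m * Real.exp u)) * |q - p|) l (𝓝 0) := by
      simpa using (hl.const_mul C).mul_const (|q - p|)
    refine squeeze_zero_norm (fun T => ?_) h2
    refine intervalIntegral.norm_integral_le_of_norm_le_const fun y hy => ?_
    rw [uIoc_of_le hpq] at hy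
    exact hbd T y hy.1.le hy.2
  have hC : ∀ T : ℝ, (∫ x in -T..T, G (x + p * Complex.I)) - (∫ x in -T..T, G (x + q * Complex.I)) =
      Complex.I * (∫ y in p..q, G ((-T : ℝ) + y * Complex.I)) - Complex.I * (∫ y in p..q, G (T + y * Complex.I)) := by
    intro T
    have := Complex.integral_boundary_rect_eq_zero_of_differentiableOn G (-T + p * Complex.I)
      (T + q * Complex.I) hG.differentiableOn
    simp at this
    push_cast
    linear_combination this
  have l1 := intervalIntegral_tendsto_integral (hInt p le_rfl hpq) tendsto_neg_atTop_atBot tendsto_id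
  have l2 := intervalIntegral_tendsto_integral (hInt q hpq le_rfl) tendsto_neg_atTop_atBot tendsto_id
  have l3 := (hvert atTop (ct_tendsto_top hm)).const_mul Complex.I
  have l4 := ((hvert atBot (ct_tendsto_bot hs hm)).comp tendsto_neg_atTop_atBot).const_mul Complex.I
  have l5 := l4.sub l3
  have l6 := l1.sub l2
  simp only [id, Function.comp] at l5 l6
  have l7 := l6.congr hC
  have := tendsto_nhds_unique l7 l5
  simpa [sub_eq_zero] using this

lemma ct_norm_exp_line (x : ℝ) (u v : ℝ) :
    (-(x : ℂ) * Complex.exp (u + v * Complex.I)).re = -x * Real.cos v * Real.exp u := by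
  rw [neg_mul, Complex.neg_re, Complex.re_ofReal_mul, Complex.exp_re]
  simp
  ring_nf

lemma ct_gamma {s : ℝ} (hs : 0 < s) {η : ℂ} (h0 : 0 ≤ η.im) (h1 : η.im < π / 2) :
    ∫ v in Ioi (0 : ℝ), ((v ^ (s - 1) : ℝ) : ℂ) * Complex.exp (-Complex.exp η * v) =
      Complex.exp (-s * η) * Real.Gamma s := by
  set F : ℂ → ℂ := fun ζ => Complex.exp (s * ζ - Complex.exp ζ) with hF
  have hFd : Differentiable ℂ F := by fun_prop
  have hrot := ct_rotate hFd (p := 0) (q := η.im) (s := s) (m := Real.cos η.im) (C := 1) h0 hs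
    (Real.cos_pos_of_mem_Ioo ⟨by linarith, h1⟩) (by
      intro u v hv1 hv2
      rw [hF, Complex.norm_exp, one_mul, ← Real.exp_add]
      apply Real.exp_le_exp.2
      have := ct_norm_exp_line 1 u v
      simp at this
      simp [this]
      have h3 : Real.cos η.im ≤ Real.cos v :=
        Real.cos_le_cos_of_nonneg_of_le_pi hv1 (by linarith [Real.pi_pos]) hv2
      nlinarith [Real.exp_pos u])
  have hG : (Real.Gamma s : ℂ) = ∫ u : ℝ, F (u + (0 : ℝ) * Complex.I) := by
    rw [Real.Gamma_eq_integral hs, ct_integral_Ioi, ← integral_complex_ofReal]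
    refine integral_congr_ae (Eventually.of_forall fun u => ?_)
    simp only [hF, smul_eq_mul]
    rw [← Real.exp_mul, ← Real.exp_add, ← Real.exp_add]
    push_cast
    congr 1; ring
  rw [ct_integral_Ioi, hG, hrot,
    ← integral_add_right_eq_self (fun u : ℝ => F (u + η.im * Complex.I)) η.re, ← integral_const_mul]
  refine integral_congr_ae (Eventually.of_forall fun u => ?_)
  simp only [hF, Complex.real_smul]
  rw [← Real.exp_mul]
  have : ((u + η.re : ℝ) : ℂ) + η.im * Complex.I = u + η := by
    push_cast; rw [add_assoc, Complex.re_add_im]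
  rw [this]
  push_cast
  rw [← Complex.exp_add, ← Complex.exp_add, ← Complex.exp_add]
  congr 1
  rw [Complex.exp_add]; ring

/-- The truncated Laplace-type integral. -/
noncomputable def ctJ (γ t : ℝ) (a : ℂ) : ℂ :=
  ∫ r in (0 : ℝ)..t, Complex.exp (a * r) * (((t - r) ^ (-γ) : ℝ) : ℂ)

noncomputable def ctK (γ t : ℝ) (η : ℂ) : ℂ :=
  Real.Gamma (1 - γ) * Complex.exp (γ * η) * Complex.exp (t * Complex.exp η) -
    Complex.exp η * ctJ γ t (Complex.exp η)

lemma ct_weight_int {γ t : ℝ} (hγ1 : γ < 1) :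
    IntervalIntegrable (fun r : ℝ => (t - r) ^ (-γ)) volume 0 t := by
  have := (intervalIntegral.intervalIntegrable_rpow' (a := 0) (b := t) (r := -γ) (by linarith)).comp_sub_left t
  simpa using this.symm

lemma ctJ_differentiable {γ t : ℝ} (hγ1 : γ < 1) (ht : 0 < t) :
    Differentiable ℂ (ctJ γ t) := by
  intro a
  have hw := ct_weight_int (γ := γ) (t := t) hγ1
  have hm : AEStronglyMeasurable (fun r : ℝ => (((t - r) ^ (-γ) : ℝ) : ℂ))
      (volume.restrict (uIoc 0 t)) := by
    have : Measurable (fun r : ℝ => (((t - r) ^ (-γ) : ℝ) : ℂ)) := by fun_prop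
    exact this.aestronglyMeasurable
  have hexp : ∀ z : ℂ, ∀ r ∈ uIoc 0 t, ‖Complex.exp (z * r)‖ ≤ Real.exp (‖z‖ * t) := by
    intro z r hr
    rw [uIoc_of_le ht.le] at hr
    refine (Complex.norm_exp_le_exp_norm _).trans (Real.exp_le_exp.2 ?_)
    rw [norm_mul, Complex.norm_real, Real.norm_of_nonneg hr.1.le]
    exact mul_le_mul_of_nonneg_left hr.2 (norm_nonneg _)
  have h := intervalIntegral.hasDerivAt_integral_of_dominated_loc_of_deriv_le
    (μ := volume) (a := 0) (b := t)
    (F := fun (z : ℂ) (r : ℝ) => Complex.exp (z * r) * (((t - r) ^ (-γ) : ℝ) : ℂ))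
    (F' := fun (z : ℂ) (r : ℝ) => (Complex.exp (z * r) * r) * (((t - r) ^ (-γ) : ℝ) : ℂ))
    (x₀ := a) (s := Metric.ball a 1)
    (bound := fun r => Real.exp ((‖a‖ + 1) * t) * t * |(t - r) ^ (-γ)|)
    (Metric.ball_mem_nhds a one_pos) ?_ ?_ ?_ ?_ ?_ ?_
  · exact h.2.differentiableAt
  · refine Eventually.of_forall fun z => AEStronglyMeasurable.mul ?_ hm
    exact (by fun_prop : Continuous fun r : ℝ => Complex.exp (z * r)).aestronglyMeasurable
  · exact IntervalIntegrable.continuousOn_mul (f := fun r : ℝ => (((t - r) ^ (-γ) : ℝ) : ℂ)) ⟨hw.1.ofReal, hw.2.ofReal⟩ (by fun_prop)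
  · refine AEStronglyMeasurable.mul ?_ hm
    exact (by fun_prop : Continuous fun r : ℝ => Complex.exp (a * r) * r).aestronglyMeasurable
  · refine Eventually.of_forall fun r hr z hz => ?_
    rw [norm_mul, norm_mul, Complex.norm_real, Complex.norm_real, Real.norm_eq_abs ((t - r) ^ (-γ))]
    have hr' := hr
    rw [uIoc_of_le ht.le] at hr'
    have hz' : ‖z‖ ≤ ‖a‖ + 1 := by
      have h1 : ‖z - a‖ < 1 := by simpa [dist_eq_norm] using hz
      have h2 := norm_sub_norm_le z a
      linarith
    have : Real.exp (‖z‖ * t) ≤ Real.exp ((‖a‖ + 1) * t) :=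
      Real.exp_le_exp.2 (mul_le_mul_of_nonneg_right hz' ht.le)
    refine mul_le_mul_of_nonneg_right ?_ (abs_nonneg _)
    refine mul_le_mul ((hexp z r hr).trans this) ?_ (norm_nonneg _) (by positivity)
    rw [Real.norm_of_nonneg hr'.1.le]; exact hr'.2
  · exact (hw.abs).const_mul _
  · refine Eventually.of_forall fun r _ z _ => ?_
    refine HasDerivAt.mul_const ?_ _
    have := ((hasDerivAt_id z).mul_const (r : ℂ)).cexp
    simpa using this

lemma ctK_differentiable {γ t : ℝ} (hγ1 : γ < 1) (ht : 0 < t) :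
    Differentiable ℂ (ctK γ t) := by
  have h := (ctJ_differentiable hγ1 ht).comp Complex.differentiable_exp
  have h2 : Differentiable ℂ (fun η : ℂ => Complex.exp η * ctJ γ t (Complex.exp η)) :=
    Complex.differentiable_exp.mul h
  unfold ctK
  exact Differentiable.sub (by fun_prop) h2

lemma ctK_real (γ t u : ℝ) : (ctK γ t u).im = 0 := by
  have : ctJ γ t (Complex.exp u) =
      ((∫ r in (0 : ℝ)..t, Real.exp (Real.exp u * r) * (t - r) ^ (-γ) : ℝ) : ℂ) := by
    rw [ctJ, ← intervalIntegral.integral_ofReal]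
    push_cast
    rfl
  have h2 : ctK γ t u = ((Real.Gamma (1 - γ) * Real.exp (γ * u) * Real.exp (t * Real.exp u) -
    Real.exp u * (∫ r in (0 : ℝ)..t, Real.exp (Real.exp u * r) * (t - r) ^ (-γ)) : ℝ) : ℂ) := by
    rw [ctK, this]; push_cast; rfl
  rw [h2, Complex.ofReal_im]

lemma ctJ_eq {γ t : ℝ} (a : ℂ) :
    ctJ γ t a = Complex.exp (t * a) *
      ∫ v in (0 : ℝ)..t, ((v ^ (-γ) : ℝ) : ℂ) * Complex.exp (-a * v) := by
  rw [ctJ, ← intervalIntegral.integral_const_mul]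
  have := intervalIntegral.integral_comp_sub_left (a := 0) (b := t)
    (fun v : ℝ => Complex.exp (t * a) * (((v ^ (-γ) : ℝ) : ℂ) * Complex.exp (-a * v))) t
  rw [sub_self, sub_zero] at this
  rw [← this]
  refine intervalIntegral.integral_congr fun r _ => ?_
  rw [mul_left_comm, ← Complex.exp_add, mul_comm]
  congr 2
  push_cast; ring

lemma ctK_bound_open {γ t : ℝ} (hγ0 : 0 < γ) (hγ1 : γ < 1) (ht : 0 < t) {η : ℂ}
    (h0 : 0 ≤ η.im) (h1 : η.im < π / 2) : ‖ctK γ t η‖ ≤ 2 * t ^ (-γ) := by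
  set a := Complex.exp η with ha
  have hare : 0 < a.re := by
    rw [ha, Complex.exp_re]
    have := Real.cos_pos_of_mem_Ioo (x := η.im) ⟨by linarith, h1⟩
    positivity
  have ha0 : a ≠ 0 := Complex.exp_ne_zero _
  set f : ℝ → ℂ := fun v => ((v ^ (-γ) : ℝ) : ℂ) * Complex.exp (-a * v) with hf
  have hnexp : ∀ v : ℝ, ‖Complex.exp (-a * v)‖ = Real.exp (-a.re * v) := by
    intro v; rw [Complex.norm_exp]; simp
  have hfm : Measurable f := by fun_prop
  have hfint : IntegrableOn f (Ioi 0) := by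
    have h := integrableOn_rpow_mul_exp_neg_mul_rpow (p := 1) (s := -γ) (b := a.re)
      (by linarith) one_pos hare
    refine Integrable.mono h hfm.aestronglyMeasurable (Eventually.of_forall fun v => ?_)
    simp only [hf, norm_mul, hnexp, Complex.norm_real, Real.rpow_one, Real.norm_eq_abs, Real.abs_exp]
    exact le_rfl
  have hgam := ct_gamma (s := 1 - γ) (by linarith) h0 h1
  rw [show (1 - γ - 1) = -γ by ring] at hgam
  have hsplit : (∫ v in (0 : ℝ)..t, f v) + ∫ v in Ioi t, f v = ∫ v in Ioi 0, f v :=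
    intervalIntegral.integral_interval_add_Ioi hfint (hfint.mono_set (Ioi_subset_Ioi ht.le))
  -- ctK in terms of the tail
  have hK : ctK γ t η = Complex.exp (t * a) * (a * ∫ v in Ioi t, f v) := by
    rw [ctK, ← ha, ctJ_eq]
    have e1 : Complex.exp (γ * η) = a * Complex.exp (-(1 - γ : ℝ) * η) := by
      rw [ha, ← Complex.exp_add]; congr 1; push_cast; ring
    rw [e1]
    have : (∫ v in (0 : ℝ)..t, f v) = Complex.exp (-(1 - γ : ℝ) * η) * Real.Gamma (1 - γ) - ∫ v in Ioi t, f v := by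
      rw [← hgam, ← hsplit]; ring
    rw [this]; ring
  set g : ℝ → ℂ := fun v => ((v ^ (-γ - 1) : ℝ) : ℂ) * Complex.exp (-a * v) with hg
  have hpow : IntegrableOn (fun v : ℝ => v ^ (-γ - 1)) (Ioi t) :=
    integrableOn_Ioi_rpow_of_lt (by linarith) ht
  have hgbd : ∀ v ∈ Ioi t, ‖g v‖ ≤ Real.exp (-a.re * t) * v ^ (-γ - 1) := by
    intro v hv
    have hv' : t < v := hv
    rw [hg]; simp only
    rw [norm_mul, hnexp, Complex.norm_real, Real.norm_of_nonneg (Real.rpow_nonneg (ht.trans hv').le _), mul_comm]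
    refine mul_le_mul_of_nonneg_right (Real.exp_le_exp.2 ?_) (Real.rpow_nonneg (ht.trans hv').le _)
    nlinarith
  have hgint : IntegrableOn g (Ioi t) := by
    refine Integrable.mono' (hpow.const_mul (Real.exp (-a.re * t))) (by fun_prop) ?_
    exact (ae_restrict_iff' measurableSet_Ioi).2 (Eventually.of_forall hgbd)
  have hibp : ∫ v in Ioi t, ((γ : ℂ) * g v + a * f v) = 0 - (-f t) := by
    refine integral_Ioi_of_hasDerivAt_of_tendsto' (f := fun v => -f v) ?_ ?_ ?_
    · intro v hv
      have hv' : 0 < v := ht.trans_le hv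
      have d1 : HasDerivAt (fun v : ℝ => ((v ^ (-γ) : ℝ) : ℂ)) ((-γ * v ^ (-γ - 1) : ℝ) : ℂ) v :=
        (Real.hasDerivAt_rpow_const (Or.inl hv'.ne')).ofReal_comp
      have d2 : HasDerivAt (fun v : ℝ => Complex.exp (-a * v)) (Complex.exp (-a * v) * (-a)) v := by
        have := ((hasDerivAt_id v).ofReal_comp.const_mul (-a)).cexp
        simpa using this
      convert! (d1.mul d2).neg using 1
      simp only [hg, hf]
      push_cast; ring
    · exact (hgint.const_mul _).add ((hfint.mono_set (Ioi_subset_Ioi ht.le)).const_mul _)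
    · have := tendsto_rpow_mul_exp_neg_mul_atTop_nhds_zero (-γ) a.re hare
      rw [← neg_zero]
      refine Tendsto.neg (tendsto_zero_iff_norm_tendsto_zero.2 ?_)
      refine this.congr' ?_
      filter_upwards [eventually_gt_atTop 0] with v hv
      simp only [hf, norm_mul, hnexp, Complex.norm_real, Real.norm_of_nonneg (Real.rpow_nonneg hv.le _)]
  have hsum : a * ∫ v in Ioi t, f v = f t - γ * ∫ v in Ioi t, g v := by
    rw [integral_add (hgint.const_mul _) ((hfint.mono_set (Ioi_subset_Ioi ht.le)).const_mul _),
      integral_const_mul, integral_const_mul] at hibp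
    linear_combination hibp
  have hft : ‖f t‖ = Real.exp (-a.re * t) * t ^ (-γ) := by
    simp only [hf, norm_mul, hnexp, Complex.norm_real, Real.norm_of_nonneg (Real.rpow_nonneg ht.le _)]
    ring
  have hgn : ‖∫ v in Ioi t, g v‖ ≤ Real.exp (-a.re * t) * (t ^ (-γ) / γ) := by
    refine (norm_integral_le_of_norm_le (hpow.const_mul (Real.exp (-a.re * t)))
      ((ae_restrict_iff' measurableSet_Ioi).2 (Eventually.of_forall hgbd))).trans_eq ?_
    rw [integral_const_mul, integral_Ioi_rpow_of_lt (by linarith) ht]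
    congr 1
    rw [show -γ - 1 + 1 = -γ by ring, neg_div_neg_eq]
  have hnt : ‖Complex.exp (t * a)‖ = Real.exp (a.re * t) := by
    rw [Complex.norm_exp]; simp [mul_comm]
  rw [hK, hsum, norm_mul, hnt]
  have hγn : ‖(γ : ℂ) * ∫ v in Ioi t, g v‖ ≤ Real.exp (-a.re * t) * t ^ (-γ) := by
    rw [norm_mul, Complex.norm_real, Real.norm_of_nonneg hγ0.le]
    refine (mul_le_mul_of_nonneg_left hgn hγ0.le).trans_eq ?_
    field_simp
  have h3 := norm_sub_le (f t) (γ * ∫ v in Ioi t, g v)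
  have h4 : Real.exp (a.re * t) * Real.exp (-a.re * t) = 1 := by
    rw [← Real.exp_add]; simp
  calc Real.exp (a.re * t) * ‖f t - γ * ∫ v in Ioi t, g v‖
      ≤ Real.exp (a.re * t) * (2 * (Real.exp (-a.re * t) * t ^ (-γ))) := by
        refine mul_le_mul_of_nonneg_left ?_ (Real.exp_pos _).le
        linarith
    _ = (Real.exp (a.re * t) * Real.exp (-a.re * t)) * (2 * t ^ (-γ)) := by ring
    _ = 2 * t ^ (-γ) := by rw [h4, one_mul]

lemma ctK_bound {γ t : ℝ} (hγ0 : 0 < γ) (hγ1 : γ < 1) (ht : 0 < t) {η : ℂ}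
    (h0 : 0 ≤ η.im) (h1 : η.im ≤ π / 2) : ‖ctK γ t η‖ ≤ 2 * t ^ (-γ) := by
  have hc : Continuous (fun k : ℝ => ‖ctK γ t (η.re + (k * η.im : ℝ) * Complex.I)‖) :=
    ((ctK_differentiable hγ1 ht).continuous.comp (by fun_prop)).norm
  have hl : Tendsto (fun k : ℝ => ‖ctK γ t (η.re + (k * η.im : ℝ) * Complex.I)‖) (𝓝[<] 1)
      (𝓝 ‖ctK γ t η‖) := by
    have := (hc.tendsto 1).mono_left (nhdsWithin_le_nhds (s := Iio 1))
    simpa using this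
  refine le_of_tendsto hl ?_
  filter_upwards [Ioo_mem_nhdsLT (show (0 : ℝ) < 1 by norm_num)] with k hk
  refine ctK_bound_open hγ0 hγ1 ht ?_ ?_
  · simpa using mul_nonneg hk.1.le h0
  · simp
    rcases h0.eq_or_lt with h | h
    · rw [← h]; simp; positivity
    · nlinarith [hk.2]

/-- The integrand in logarithmic coordinates. -/
noncomputable def ctG (α L x r : ℝ) (ζ : ℂ) : ℂ :=
  Complex.exp (-(x : ℂ) * Complex.exp ζ + r * Complex.exp (L + α * ζ) + ζ)

lemma ct_exp_line_re (α L u v : ℝ) :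
    (Complex.exp (L + α * (u + v * Complex.I))).re = Real.exp (L + α * u) * Real.cos (α * v) := by
  rw [Complex.exp_re]; simp

lemma ctG_norm (α L x r u v : ℝ) :
    ‖ctG α L x r (u + v * Complex.I)‖ =
      Real.exp (-x * Real.cos v * Real.exp u + r * (Real.exp (L + α * u) * Real.cos (α * v)) + u) := by
  rw [ctG, Complex.norm_exp, Complex.add_re, Complex.add_re, ct_norm_exp_line,
    Complex.re_ofReal_mul, ct_exp_line_re]
  simp

lemma ctG_differentiable (α L x r : ℝ) : Differentiable ℂ (ctG α L x r) := by
  unfold ctG; fun_prop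

lemma ctG_bound {α : ℝ} (hα1 : 1 < α) (hα2 : α ≤ 2) (L : ℝ) {x r : ℝ} (hx : 0 < x) (hr : 0 < r) :
    ∃ m C : ℝ, 0 < m ∧ ∀ u v : ℝ, π / (2 * α) ≤ v → v ≤ π / 2 →
      ‖ctG α L x r (u + v * Complex.I)‖ ≤ C * (Real.exp (1 * u) * Real.exp (-m * Real.exp u)) := by
  have hα0 : 0 < α := by linarith
  have hpi := Real.pi_pos
  have hle : π / (2 * α) ≤ π / 2 := by
    apply div_le_div_of_nonneg_left hpi.le two_pos; linarith
  have hpos : 0 < π / (2 * α) := by positivity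
  have hav : ∀ v, π / (2 * α) ≤ v → v ≤ π / 2 → π / 2 ≤ α * v ∧ α * v ≤ π := by
    intro v h1 h2
    constructor
    · rw [div_le_iff₀ (by positivity)] at h1; linarith
    · nlinarith
  have hcos : ∀ v, π / (2 * α) ≤ v → v ≤ π / 2 → 0 ≤ Real.cos v ∧ Real.cos (α * v) ≤ 0 := by
    intro v h1 h2
    obtain ⟨h3, h4⟩ := hav v h1 h2
    exact ⟨Real.cos_nonneg_of_mem_Icc ⟨by linarith, h2⟩,
      Real.cos_nonpos_of_pi_div_two_le_of_le h3 (by linarith)⟩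
  obtain ⟨v0, hv0, hmin⟩ := (isCompact_Icc (a := π / (2 * α)) (b := π / 2)).exists_isMinOn
    (f := fun v => Real.cos v - Real.cos (α * v)) (nonempty_Icc.2 hle) (by fun_prop)
  set δ := Real.cos v0 - Real.cos (α * v0) with hδ
  have hδ0 : 0 < δ := by
    obtain ⟨h3, h4⟩ := hcos v0 hv0.1 hv0.2
    rcases hv0.2.eq_or_lt with h | h
    · have : Real.cos (α * v0) < 0 :=
        Real.cos_neg_of_pi_div_two_lt_of_lt (by rw [h]; nlinarith) (by nlinarith [(hav v0 hv0.1 hv0.2).2])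
      linarith
    · have : 0 < Real.cos v0 := Real.cos_pos_of_mem_Ioo ⟨by linarith [hv0.1], h⟩
      linarith
  set k := r * Real.exp L with hk
  have hk0 : 0 < k := by positivity
  set m := min x k * δ with hm
  have hm0 : 0 < m := mul_pos (lt_min hx hk0) hδ0
  refine ⟨m, Real.exp m, hm0, fun u v h1 h2 => ?_⟩
  rw [ctG_norm, ← Real.exp_add, ← Real.exp_add]
  apply Real.exp_le_exp.2
  obtain ⟨h3, h4⟩ := hcos v h1 h2
  have h5 : δ ≤ Real.cos v - Real.cos (α * v) := hmin ⟨h1, h2⟩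
  have eu := Real.exp_pos u
  have eL : r * (Real.exp (L + α * u) * Real.cos (α * v)) = -(k * Real.exp (α * u) * (-Real.cos (α * v))) := by
    rw [Real.exp_add, hk]; ring
  rw [eL]
  have h6 : 0 ≤ k * Real.exp (α * u) * (-Real.cos (α * v)) := by
    have : 0 ≤ -Real.cos (α * v) := by linarith
    positivity
  have h7 : 0 ≤ x * Real.cos v * Real.exp u := by positivity
  rcases le_or_gt 0 u with hu | hu
  · have h8 : Real.exp u ≤ Real.exp (α * u) := Real.exp_le_exp.2 (by nlinarith)
    have h9 : k * Real.exp u * (-Real.cos (α * v)) ≤ k * Real.exp (α * u) * (-Real.cos (α * v)) := by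
      gcongr; linarith
    have h10 : min x k * Real.cos v ≤ x * Real.cos v := by gcongr; exact min_le_left _ _
    have h11 : min x k * (-Real.cos (α * v)) ≤ k * (-Real.cos (α * v)) := by
      gcongr
      · linarith
      · exact min_le_right _ _
    have h12 : m ≤ x * Real.cos v + k * (-Real.cos (α * v)) := by
      have : m ≤ min x k * (Real.cos v - Real.cos (α * v)) := by
        rw [hm]; gcongr
      linarith
    have h13 := mul_le_mul_of_nonneg_right h12 eu.le
    nlinarith
  · have : Real.exp u ≤ 1 := Real.exp_le_one_iff.2 hu.le
    nlinarith

lemma ct_density {α : ℝ} (hα1 : 1 < α) (hα2 : α ≤ 2) (L : ℝ) {x r : ℝ} (hx : 0 < x) (hr : 0 < r) :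
    zolDensity α (2 - α) (Real.exp L * r) x =
      (1 / π) * (∫ u : ℝ, ctG α L x r (u + (π / (2 * α) : ℝ) * Complex.I)).im := by
  have hα0 : 0 < α := by linarith
  have hpi := Real.pi_pos
  obtain ⟨m, C, hm, hbd⟩ := ctG_bound hα1 hα2 L hx hr
  have hle : π / (2 * α) ≤ π / 2 := by
    apply div_le_div_of_nonneg_left hpi.le two_pos; linarith
  rw [ct_rotate (ctG_differentiable α L x r) hle one_pos hm hbd]
  have hGint : Integrable (fun u : ℝ => ctG α L x r (u + (π / 2 : ℝ) * Complex.I)) := by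
    refine ((ct_integrable_exp one_pos hm).const_mul C).mono' ?_
      (Eventually.of_forall fun u => hbd u _ hle le_rfl)
    exact ((ctG_differentiable α L x r).continuous.comp (by fun_prop)).aestronglyMeasurable
  rw [zolDensity]
  set k := Real.exp L * r with hk
  have hk0 : 0 < k := by positivity
  set f : ℝ → ℂ := fun l => Complex.exp (-Complex.I * (l : ℂ) * (x : ℂ)) *
        Complex.exp (-(k : ℂ) * ((|l| ^ α : ℝ) : ℂ) *
          Complex.exp (-Complex.I * (Real.pi : ℂ) * ((2 - α : ℝ) : ℂ) * ((Real.sign l : ℝ) : ℂ) / 2)) with hf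
  set κ := Real.cos (π * (2 - α) / 2) with hκ
  have hκ0 : 0 < κ := by
    apply Real.cos_pos_of_mem_Ioo
    constructor <;> nlinarith
  have hfm : Measurable f := by
    have hsm : Measurable Real.sign := by
      unfold Real.sign
      exact Measurable.ite measurableSet_Iio measurable_const
        (Measurable.ite measurableSet_Ioi measurable_const measurable_const)
    fun_prop
  have hfn : ∀ l, ‖f l‖ = Real.exp (-(k * κ) * |l| ^ α) := by
    intro l
    simp only [hf]
    rw [norm_mul, Complex.norm_exp, Complex.norm_exp, ← Real.exp_add]
    congr 1
    rw [show -(k : ℂ) * ((|l| ^ α : ℝ) : ℂ) = ((-k * |l| ^ α : ℝ) : ℂ) by push_cast; ring,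
      Complex.re_ofReal_mul,
      show -Complex.I * (π : ℂ) * ((2 - α : ℝ) : ℂ) * ((Real.sign l : ℝ) : ℂ) / 2 =
        ((-(π * (2 - α) / 2 * Real.sign l) : ℝ) : ℂ) * Complex.I by push_cast; ring,
      Complex.exp_ofReal_mul_I_re]
    rcases lt_trichotomy l 0 with h | h | h
    · rw [Real.sign_of_neg h]; simp [hκ]; ring
    · subst h; simp [Real.zero_rpow hα0.ne']
    · rw [Real.sign_of_pos h]; simp [hκ]; ring
  have hfint : Integrable f := by
    have h1 : Integrable (fun l : ℝ => Real.exp (-(k * κ) * |l| ^ α)) := by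
      by_contra hcon
      have h2 := integral_comp_abs (f := fun l : ℝ => Real.exp (-(k * κ) * l ^ α))
      rw [integral_undef hcon, integral_exp_neg_mul_rpow hα0 (by positivity)] at h2
      have : 0 < Real.Gamma (1 / α + 1) := Real.Gamma_pos_of_pos (by positivity)
      have : 0 < 2 * ((k * κ) ^ (-1 / α) * Real.Gamma (1 / α + 1)) := by positivity
      linarith
    exact h1.mono' hfm.aestronglyMeasurable (Eventually.of_forall fun l => (hfn l).le)
  have hconj : ∀ l, f (-l) = (starRingEnd ℂ) (f l) := by
    intro l
    simp only [hf, map_mul, ← Complex.exp_conj, Real.sign_neg, abs_neg, map_neg, Complex.conj_I,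
      Complex.conj_ofReal, map_div₀]
    push_cast
    simp only [map_ofNat]
    congr 2
    · ring
    · congr 2; ring
  have heven : ∀ l, (f l).re = (f |l|).re := by
    intro l
    rcases abs_choice l with h | h
    · rw [h]
    · rw [h, hconj, Complex.conj_re]
  have hre : (∫ l, f l).re = ∫ l, (f l).re := (Complex.reCLM.integral_comp_comm hfint).symm
  have him : (∫ u : ℝ, ctG α L x r (u + (π / 2 : ℝ) * Complex.I)).im =
      ∫ u : ℝ, (ctG α L x r (u + (π / 2 : ℝ) * Complex.I)).im :=
    (Complex.imCLM.integral_comp_comm hGint).symm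
  rw [hre, him]
  rw [integral_congr_ae (Eventually.of_forall heven)]
  rw [integral_comp_abs (f := fun l => (f l).re), ct_integral_Ioi]
  have hpt : ∀ u : ℝ, Real.exp u • (f (Real.exp u)).re =
      (ctG α L x r (u + (π / 2 : ℝ) * Complex.I)).im := by
    intro u
    have e1 : Complex.exp (u + (π / 2 : ℝ) * Complex.I) = Complex.I * Real.exp u := by
      rw [Complex.exp_add]
      push_cast
      rw [Complex.exp_pi_div_two_mul_I, mul_comm]
    have e2 : (r : ℂ) * Complex.exp (L + α * (u + (π / 2 : ℝ) * Complex.I)) =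
        -(k : ℂ) * ((|Real.exp u| ^ α : ℝ) : ℂ) *
          Complex.exp (-Complex.I * (Real.pi : ℂ) * ((2 - α : ℝ) : ℂ) * ((1 : ℝ) : ℂ) / 2) := by
      rw [Real.abs_exp, ← Real.exp_mul, hk]
      push_cast
      have : (-1 : ℂ) = Complex.exp (π * Complex.I) := Complex.exp_pi_mul_I.symm
      rw [neg_mul, neg_mul, ← neg_one_mul, this]
      have e3 : Complex.exp L * r * Complex.exp (u * α) = r * (Complex.exp L * Complex.exp (u * α)) := by ring
      rw [e3, mul_assoc, mul_left_comm _ (r : ℂ), ← Complex.exp_add, ← Complex.exp_add, ← Complex.exp_add]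
      congr 2
      ring
    have e4 : ctG α L x r (u + (π / 2 : ℝ) * Complex.I) = Complex.I * (Real.exp u * f (Real.exp u)) := by
      rw [ctG, e2, Complex.exp_add, Complex.exp_add, e1]
      simp only [hf, Real.sign_of_pos (Real.exp_pos u)]
      rw [show -(x : ℂ) * (Complex.I * Real.exp u) = -Complex.I * (Real.exp u : ℝ) * x by ring]
      ring
    rw [e4, Complex.I_mul_im, Complex.re_ofReal_mul, smul_eq_mul]
  simp_rw [hpt]
  field_simp

lemma ctG_split (α L x t : ℝ) (ζ : ℂ) :
    ctG α L x t ζ = Complex.exp (t * Complex.exp (L + α * ζ)) * ctG α L x 0 ζ := by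
  rw [ctG, ctG, ← Complex.exp_add]; congr 1; push_cast; ring

lemma ctG_norm_line {α : ℝ} (hα : 0 < α) (L x r u : ℝ) :
    ‖ctG α L x r (u + (π / (2 * α) : ℝ) * Complex.I)‖ =
      Real.exp (1 * u) * Real.exp (-(x * Real.cos (π / (2 * α))) * Real.exp u) := by
  rw [ctG_norm, show α * (π / (2 * α)) = π / 2 by field_simp, Real.cos_pi_div_two, ← Real.exp_add]
  congr 1; ring

lemma ct_norm_exp_eta (α L θ u : ℝ) :
    ‖Complex.exp (L + α * (u + θ * Complex.I))‖ = Real.exp L * Real.exp (α * u) := by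
  rw [Complex.norm_exp, ← Real.exp_add]; simp

lemma ct_cont_eta (α L θ : ℝ) :
    Continuous (fun u : ℝ => Complex.exp (L + α * (u + θ * Complex.I))) := by fun_prop

lemma ct_cont_G (α L x r θ : ℝ) :
    Continuous (fun u : ℝ => ctG α L x r (u + θ * Complex.I)) :=
  (ctG_differentiable α L x r).continuous.comp (by fun_prop)

lemma ct_cos_pos {α : ℝ} (hα1 : 1 < α) : 0 < Real.cos (π / (2 * α)) := by
  have hpi := Real.pi_pos
  apply Real.cos_pos_of_mem_Ioo
  constructor
  · have : 0 < π / (2 * α) := by positivity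
    linarith
  · apply div_lt_div_of_pos_left hpi two_pos; linarith

lemma ct_integrable_G {α : ℝ} (hα1 : 1 < α) (L r : ℝ) {x : ℝ} (hx : 0 < x) :
    Integrable (fun u : ℝ => ctG α L x r (u + (π / (2 * α) : ℝ) * Complex.I)) := by
  have hκ := ct_cos_pos hα1
  refine (ct_integrable_exp one_pos (mul_pos hx hκ)).mono' (ct_cont_G _ _ _ _ _).aestronglyMeasurable
    (Eventually.of_forall fun u => (ctG_norm_line (by linarith) L x r u).le)

lemma ct_eta_bound {α : ℝ} (hα1 : 1 < α) (L x r u : ℝ) :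
    ‖Complex.exp (L + α * (u + (π / (2 * α) : ℝ) * Complex.I)) *
      ctG α L x r (u + (π / (2 * α) : ℝ) * Complex.I)‖ ≤
     Real.exp L * (Real.exp ((α + 1) * u) * Real.exp (-(x * Real.cos (π / (2 * α))) * Real.exp u)) := by
  rw [norm_mul, ct_norm_exp_eta, ctG_norm_line (by linarith), add_mul, Real.exp_add (α * u)]
  apply le_of_eq; ring

lemma ct_hasDerivAt_r {α : ℝ} (hα1 : 1 < α) (L r : ℝ) {x : ℝ} (hx : 0 < x) :
    HasDerivAt (fun r : ℝ => ∫ u : ℝ, ctG α L x r (u + (π / (2 * α) : ℝ) * Complex.I))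
      (∫ u : ℝ, Complex.exp (L + α * (u + (π / (2 * α) : ℝ) * Complex.I)) *
        ctG α L x r (u + (π / (2 * α) : ℝ) * Complex.I)) r := by
  have hκ := ct_cos_pos hα1
  refine (hasDerivAt_integral_of_dominated_loc_of_deriv_le (μ := volume) (s := univ)
    (F := fun (r u : ℝ) => ctG α L x r (u + (π / (2 * α) : ℝ) * Complex.I))
    (F' := fun (r u : ℝ) => Complex.exp (L + α * (u + (π / (2 * α) : ℝ) * Complex.I)) *
        ctG α L x r (u + (π / (2 * α) : ℝ) * Complex.I))
    (bound := fun u => Real.exp L * (Real.exp ((α + 1) * u) *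
      Real.exp (-(x * Real.cos (π / (2 * α))) * Real.exp u)))
    univ_mem (Eventually.of_forall fun r => (ct_cont_G _ _ _ _ _).aestronglyMeasurable)
    (ct_integrable_G hα1 L r hx)
    ((ct_cont_eta _ _ _).mul (ct_cont_G _ _ _ _ _)).aestronglyMeasurable
    (Eventually.of_forall fun u r _ => ct_eta_bound hα1 L x r u)
    ((ct_integrable_exp (by linarith) (mul_pos hx hκ)).const_mul _)
    (Eventually.of_forall fun u r _ => ?_)).2
  simp only [ctG]
  have h1 := ((((hasDerivAt_id r).ofReal_comp).mul_const
    (Complex.exp (L + α * (u + (π / (2 * α) : ℝ) * Complex.I)))).const_add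
      (-(x : ℂ) * Complex.exp (u + (π / (2 * α) : ℝ) * Complex.I))).add_const
      ((u : ℂ) + (π / (2 * α) : ℝ) * Complex.I)
  have h2 := h1.cexp
  simp only [id, Complex.ofReal_one, one_mul] at h2
  exact h2.congr_deriv (mul_comm _ _)

lemma ct_hasDerivAt_x {α : ℝ} (hα1 : 1 < α) (L r : ℝ) {x : ℝ} (hx : 0 < x) :
    HasDerivAt (fun x : ℝ => ∫ u : ℝ, ctG α L x r (u + (π / (2 * α) : ℝ) * Complex.I))
      (∫ u : ℝ, -Complex.exp (u + (π / (2 * α) : ℝ) * Complex.I) *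
        ctG α L x r (u + (π / (2 * α) : ℝ) * Complex.I)) x := by
  have hκ := ct_cos_pos hα1
  refine (hasDerivAt_integral_of_dominated_loc_of_deriv_le (μ := volume) (s := Ioi (x / 2))
    (F := fun (x u : ℝ) => ctG α L x r (u + (π / (2 * α) : ℝ) * Complex.I))
    (F' := fun (x u : ℝ) => -Complex.exp (u + (π / (2 * α) : ℝ) * Complex.I) *
        ctG α L x r (u + (π / (2 * α) : ℝ) * Complex.I))
    (bound := fun u => Real.exp (2 * u) *
      Real.exp (-(x / 2 * Real.cos (π / (2 * α))) * Real.exp u))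
    (Ioi_mem_nhds (by linarith)) (Eventually.of_forall fun r => (ct_cont_G _ _ _ _ _).aestronglyMeasurable)
    (ct_integrable_G hα1 L r hx)
    (Continuous.mul (by fun_prop) (ct_cont_G _ _ _ _ _)).aestronglyMeasurable
    (Eventually.of_forall fun u y hy => ?_)
    (ct_integrable_exp (by linarith) (mul_pos (by linarith) hκ))
    (Eventually.of_forall fun u y _ => ?_)).2
  · have hy' : x / 2 < y := hy
    rw [norm_mul, norm_neg, ctG_norm_line (by linarith), Complex.norm_exp]
    simp only [Complex.add_re, Complex.ofReal_re, Complex.re_ofReal_mul, Complex.I_re, mul_zero, add_zero]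
    rw [← Real.exp_add, ← Real.exp_add, ← Real.exp_add]
    apply Real.exp_le_exp.2
    have : x / 2 * Real.cos (π / (2 * α)) * Real.exp u ≤ y * Real.cos (π / (2 * α)) * Real.exp u := by
      gcongr
    linarith
  · simp only [ctG]
    have h1 := (((((hasDerivAt_id y).ofReal_comp).neg).mul_const
      (Complex.exp (u + (π / (2 * α) : ℝ) * Complex.I))).add_const
        ((r : ℂ) * Complex.exp (L + α * (u + (π / (2 * α) : ℝ) * Complex.I)))).add_const
        ((u : ℂ) + (π / (2 * α) : ℝ) * Complex.I)
    have h2 := h1.cexp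
    refine h2.congr_deriv ?_
    rw [mul_comm, Complex.ofReal_one, neg_one_mul]
    rfl

lemma ct_tail {α γ L x t : ℝ} (hα1 : 1 < α) (hγ : γ = 1 / α) (hx : 0 < x) (ht : 0 < t) :
    Integrable (fun u : ℝ => ctK γ t (L + α * (u + (π / (2 * α) : ℝ) * Complex.I)) *
        ctG α L x 0 (u + (π / (2 * α) : ℝ) * Complex.I)) ∧
    (∫ u : ℝ, ctK γ t (L + α * (u + (π / (2 * α) : ℝ) * Complex.I)) *
        ctG α L x 0 (u + (π / (2 * α) : ℝ) * Complex.I)).im = 0 := by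
  have hα0 : 0 < α := by linarith
  have hpi := Real.pi_pos
  have hκ := ct_cos_pos hα1
  have hγ0 : 0 < γ := by rw [hγ]; positivity
  have hγ1 : γ < 1 := by rw [hγ, div_lt_one hα0]; exact hα1
  set θ := π / (2 * α) with hθ
  have hθ0 : 0 < θ := by positivity
  have hθ1 : θ ≤ π / 2 := by
    apply div_le_div_of_nonneg_left hpi.le two_pos; linarith
  have hαθ : α * θ = π / 2 := by rw [hθ]; field_simp
  set F : ℂ → ℂ := fun ζ => ctK γ t (L + α * ζ) * ctG α L x 0 ζ with hF
  have hFd : Differentiable ℂ F :=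
    ((ctK_differentiable hγ1 ht).comp (by fun_prop)).mul (ctG_differentiable _ _ _ _)
  have hbd : ∀ u v : ℝ, 0 ≤ v → v ≤ θ → ‖F (u + v * Complex.I)‖ ≤
      2 * t ^ (-γ) * (Real.exp (1 * u) * Real.exp (-(x * Real.cos θ) * Real.exp u)) := by
    intro u v h1 h2
    simp only [hF]
    rw [norm_mul]
    refine mul_le_mul (ctK_bound hγ0 hγ1 ht ?_ ?_) ?_ (norm_nonneg _) (by positivity)
    · simpa using mul_nonneg hα0.le h1
    · simp; nlinarith
    · rw [ctG_norm, ← Real.exp_add]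
      apply Real.exp_le_exp.2
      have h3 : Real.cos θ ≤ Real.cos v := Real.cos_le_cos_of_nonneg_of_le_pi h1 (by linarith) h2
      have : x * Real.cos θ * Real.exp u ≤ x * Real.cos v * Real.exp u := by gcongr
      linarith
  refine ⟨?_, ?_⟩
  · refine ((ct_integrable_exp one_pos (mul_pos hx hκ)).const_mul (2 * t ^ (-γ))).mono' ?_
      (Eventually.of_forall fun u => hbd u θ hθ0.le le_rfl)
    exact (hFd.continuous.comp (by fun_prop)).aestronglyMeasurable
  · have h := ct_rotate hFd hθ0.le one_pos (mul_pos hx hκ) hbd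
    change (∫ u : ℝ, F (u + θ * Complex.I)).im = 0
    rw [← h]
    have hreal : ∀ u : ℝ, F (u + (0 : ℝ) * Complex.I) = (((F (u + (0 : ℝ) * Complex.I)).re : ℝ) : ℂ) := by
      intro u
      apply Complex.ext
      · simp
      · rw [Complex.ofReal_im]
        have e1 : (ctK γ t (L + α * (u + (0 : ℝ) * Complex.I))).im = 0 := by
          have := ctK_real γ t (L + α * u)
          simpa using this
        have e2 : (ctG α L x 0 (u + (0 : ℝ) * Complex.I)).im = 0 := by
          have : ctG α L x 0 (u + (0 : ℝ) * Complex.I) = ((Real.exp (-x * Real.exp u + u) : ℝ) : ℂ) := by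
            rw [ctG]; push_cast; simp
          rw [this, Complex.ofReal_im]
        simp only [hF]
        rw [Complex.mul_im, e1, e2]; ring
    rw [integral_congr_ae (Eventually.of_forall hreal), integral_complex_ofReal, Complex.ofReal_im]

lemma ct_caputo {α γ L x t : ℝ} (hα1 : 1 < α) (hγ : γ = 1 / α) (hx : 0 < x) (ht : 0 < t) :
    IntervalIntegrable (fun r : ℝ => (∫ u : ℝ, Complex.exp (L + α * (u + (π / (2 * α) : ℝ) * Complex.I)) *
        ctG α L x r (u + (π / (2 * α) : ℝ) * Complex.I)) * (((t - r) ^ (-γ) : ℝ) : ℂ)) volume 0 t ∧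
    (∫ r in (0 : ℝ)..t, (∫ u : ℝ, Complex.exp (L + α * (u + (π / (2 * α) : ℝ) * Complex.I)) *
        ctG α L x r (u + (π / (2 * α) : ℝ) * Complex.I)) * (((t - r) ^ (-γ) : ℝ) : ℂ)) =
    ∫ u : ℝ, Complex.exp (L + α * (u + (π / (2 * α) : ℝ) * Complex.I)) *
      ctJ γ t (Complex.exp (L + α * (u + (π / (2 * α) : ℝ) * Complex.I))) *
        ctG α L x 0 (u + (π / (2 * α) : ℝ) * Complex.I) := by
  have hα0 : 0 < α := by linarith
  have hκ := ct_cos_pos hα1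
  have hγ1 : γ < 1 := by rw [hγ, div_lt_one hα0]; exact hα1
  set θ := π / (2 * α) with hθ
  have hw := (ct_weight_int (γ := γ) (t := t) hγ1)
  rw [intervalIntegrable_iff_integrableOn_Ioc_of_le ht.le] at hw
  set Φ : ℝ → ℝ → ℂ := fun r u => Complex.exp (L + α * (u + θ * Complex.I)) *
        ctG α L x r (u + θ * Complex.I) * (((t - r) ^ (-γ) : ℝ) : ℂ) with hΦ
  have hInt : Integrable (Function.uncurry Φ) ((volume.restrict (Ioc 0 t)).prod volume) := by
    have hb := hw.norm.mul_prod (ν := volume) ((ct_integrable_exp (s := α + 1) (by linarith) (mul_pos hx hκ)).const_mul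
      (Real.exp L))
    refine hb.mono' ?_ (Eventually.of_forall fun p => ?_)
    · have : Measurable (Function.uncurry Φ) := by
        simp only [hΦ, ctG, Function.uncurry_def]
        fun_prop
      exact this.aestronglyMeasurable
    · simp only [Function.uncurry_def, hΦ]
      rw [norm_mul, Complex.norm_real, mul_comm]
      exact mul_le_mul_of_nonneg_left (ct_eta_bound hα1 L x p.1 p.2) (norm_nonneg _)
  have hin : ∀ r : ℝ, (∫ u : ℝ, Complex.exp (L + α * (u + θ * Complex.I)) *
        ctG α L x r (u + θ * Complex.I)) * (((t - r) ^ (-γ) : ℝ) : ℂ) = ∫ u, Φ r u := by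
    intro r
    rw [← integral_mul_const]
  simp_rw [hin]
  refine ⟨?_, ?_⟩
  · rw [intervalIntegrable_iff_integrableOn_Ioc_of_le ht.le]
    exact hInt.integral_prod_left
  · rw [intervalIntegral.integral_of_le ht.le, integral_integral_swap hInt]
    refine integral_congr_ae (Eventually.of_forall fun u => ?_)
    simp only
    rw [ctJ, intervalIntegral.integral_of_le ht.le, ← integral_const_mul, ← integral_mul_const]
    refine integral_congr_ae (Eventually.of_forall fun r => ?_)
    simp only [hΦ]
    rw [ctG_split, mul_comm (r : ℂ)]
    ring

/-- Caputo-in-time equation for a spectrally negative stable density. -/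
theorem caputo_in_time (α b : ℝ) (hα1 : 1 < α) (hα2 : α ≤ 2) (hb : 0 < b)
    (γ : ℝ) (hγ : γ = 1 / α)
    (P : ℝ → ℝ → ℝ) (hP : ∀ x t, P x t = zolDensity α (2 - α) (b ^ (-α) * t) x) :
    ∀ x t : ℝ, 0 < x → 0 < t →
      b * ((1 / Real.Gamma (1 - γ)) *
          ∫ r in (0 : ℝ)..t, deriv (fun s => P x s) r * (t - r) ^ (-γ)) =
        -(deriv (fun y => P y t) x) := by
  intro x t hx ht
  have hα0 : 0 < α := by linarith
  have hγ1 : γ < 1 := by rw [hγ, div_lt_one hα0]; exact hα1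
  have hΓ : 0 < Real.Gamma (1 - γ) := Real.Gamma_pos_of_pos (by linarith)
  set L : ℝ := -α * Real.log b with hL
  have hexpL : b ^ (-α) = Real.exp L := by
    rw [Real.rpow_def_of_pos hb, hL, mul_comm]
  have hPd : ∀ y s : ℝ, 0 < y → 0 < s → P y s =
      (1 / π) * (∫ u : ℝ, ctG α L y s (u + (π / (2 * α) : ℝ) * Complex.I)).im := by
    intro y s hy hs
    rw [hP, hexpL, ct_density hα1 hα2 L hy hs]
  have hdr : ∀ r : ℝ, 0 < r → deriv (fun s => P x s) r =
      (1 / π) * (∫ u : ℝ, Complex.exp (L + α * (u + (π / (2 * α) : ℝ) * Complex.I)) *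
        ctG α L x r (u + (π / (2 * α) : ℝ) * Complex.I)).im := by
    intro r hr
    have h := Complex.imCLM.hasFDerivAt.comp_hasDerivAt r (ct_hasDerivAt_r hα1 L r hx)
    have h2 := h.const_mul (1 / π)
    refine HasDerivAt.deriv (h2.congr_of_eventuallyEq ?_)
    filter_upwards [Ioi_mem_nhds hr] with s hs
    exact hPd x s hx hs
  have hdx : deriv (fun y => P y t) x =
      (1 / π) * (∫ u : ℝ, -Complex.exp (u + (π / (2 * α) : ℝ) * Complex.I) *
        ctG α L x t (u + (π / (2 * α) : ℝ) * Complex.I)).im := by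
    have h := Complex.imCLM.hasFDerivAt.comp_hasDerivAt x (ct_hasDerivAt_x hα1 L t hx)
    have h2 := h.const_mul (1 / π)
    refine HasDerivAt.deriv (h2.congr_of_eventuallyEq ?_)
    filter_upwards [Ioi_mem_nhds hx] with s hs
    exact hPd s t hs ht
  obtain ⟨hci, hce⟩ := ct_caputo (L := L) hα1 hγ hx ht
  obtain ⟨hti, hte⟩ := ct_tail (L := L) hα1 hγ hx ht
  have hcap : (∫ r in (0 : ℝ)..t, deriv (fun s => P x s) r * (t - r) ^ (-γ)) = (1 / π) *
      (∫ r in (0 : ℝ)..t, (∫ u : ℝ, Complex.exp (L + α * (u + (π / (2 * α) : ℝ) * Complex.I)) *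
        ctG α L x r (u + (π / (2 * α) : ℝ) * Complex.I)) * (((t - r) ^ (-γ) : ℝ) : ℂ)).im := by
    have h := Complex.imCLM.intervalIntegral_comp_comm hci
    simp only [Complex.imCLM_apply] at h
    rw [← h, ← intervalIntegral.integral_const_mul]
    rw [intervalIntegral.integral_of_le ht.le, intervalIntegral.integral_of_le ht.le]
    refine setIntegral_congr_fun measurableSet_Ioc fun r hr => ?_
    rw [hdr r hr.1, Complex.im_mul_ofReal]
    ring
  have hJ : ∀ u : ℝ, Complex.exp (L + α * (u + (π / (2 * α) : ℝ) * Complex.I)) *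
      ctJ γ t (Complex.exp (L + α * (u + (π / (2 * α) : ℝ) * Complex.I))) *
        ctG α L x 0 (u + (π / (2 * α) : ℝ) * Complex.I) =
      -((Real.Gamma (1 - γ) / b : ℝ) : ℂ) * (-Complex.exp (u + (π / (2 * α) : ℝ) * Complex.I) *
        ctG α L x t (u + (π / (2 * α) : ℝ) * Complex.I)) -
      ctK γ t (L + α * (u + (π / (2 * α) : ℝ) * Complex.I)) *
        ctG α L x 0 (u + (π / (2 * α) : ℝ) * Complex.I) := by
    intro u
    set ζ : ℂ := u + (π / (2 * α) : ℝ) * Complex.I with hζ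
    have e1 : Complex.exp (γ * (L + α * ζ)) = (b : ℂ)⁻¹ * Complex.exp ζ := by
      have hγα : (γ : ℂ) * α = 1 := by
        rw [← Complex.ofReal_mul, hγ, one_div_mul_cancel hα0.ne', Complex.ofReal_one]
      have : γ * (L + α * ζ) = ((-Real.log b : ℝ) : ℂ) + ζ := by
        rw [hL]; push_cast
        linear_combination (ζ - (Real.log b : ℂ)) * hγα
      rw [this, Complex.exp_add, ← Complex.ofReal_exp, Real.exp_neg, Real.exp_log hb, Complex.ofReal_inv]
    rw [ctK, e1, ctG_split α L x t]
    push_cast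
    ring
  have hGi : Integrable (fun u : ℝ => -Complex.exp (u + (π / (2 * α) : ℝ) * Complex.I) *
        ctG α L x t (u + (π / (2 * α) : ℝ) * Complex.I)) := by
    have hκ := ct_cos_pos hα1
    refine (ct_integrable_exp (s := 2) two_pos (mul_pos hx hκ)).mono'
      (Continuous.mul (by fun_prop) (ct_cont_G _ _ _ _ _)).aestronglyMeasurable
      (Eventually.of_forall fun u => ?_)
    rw [norm_mul, norm_neg, ctG_norm_line (by linarith), Complex.norm_exp]
    simp only [Complex.add_re, Complex.ofReal_re, Complex.re_ofReal_mul, Complex.I_re, mul_zero, add_zero]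
    rw [← Real.exp_add, ← Real.exp_add, ← Real.exp_add]
    apply Real.exp_le_exp.2
    linarith
  rw [hcap, hce, integral_congr_ae (Eventually.of_forall hJ), integral_sub (hGi.const_mul _) hti,
    integral_const_mul, Complex.sub_im, hte, hdx, ← Complex.ofReal_neg, Complex.im_ofReal_mul]
  field_simp
  ring
end
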